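/- For every κ > 0 there exist κ′ > 0, a constant C > 0 and a bound p₀ such that the following holds for every prime p ≥ p₀, with G = SL₂(ℤ/pℤ). Let μ : G → ℂ be any complex-valued function (complex measure) satisfying max_{x∈G} |μ(x)| < p^{−κ}·‖μ‖₁ and, for every proper subgroup G₁ of G and every a ∈ G, Σ_{x ∈ aG₁} |μ(x)| < p^{−κ}·‖μ‖₁. Then for every φ : G → ℂ with Σ_{x∈G} φ(x) = 0, one has ‖μ ∗ φ‖₂ ≤ C·p^{−κ′}·‖μ‖₁·‖φ‖₂. -/

import Mathlib

open Finset
open scoped Classical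

/-- Convolution of two complex-valued functions on a finite group:
`(μ ∗ φ)(x) = Σ_g μ(g) φ(g⁻¹ x)`. -/
noncomputable def conv {G : Type*} [Group G] [Fintype G] (μ φ : G → ℂ) : G → ℂ :=
  fun x => ∑ g : G, μ g * φ (g⁻¹ * x)

/-- The `ℓ¹` norm `Σ_x |μ(x)|` of a function on a finite group. -/
noncomputable def l1Norm {G : Type*} [Fintype G] (μ : G → ℂ) : ℝ :=
  ∑ x : G, ‖μ x‖

/-- The `ℓ²` norm `(Σ_x |φ(x)|²)^{1/2}` of a function on a finite group. -/
noncomputable def l2Norm {G : Type*} [Fintype G] (φ : G → ℂ) : ℝ :=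
  Real.sqrt (∑ x : G, ‖φ x‖ ^ 2)

section ApproximateSubgroups

open scoped Pointwise

variable {G : Type*}

/-- If every `s ∈ S` has at least `c` representations `s = y⁻¹ z` with `y, z ∈ A`, then
inserting `S` between `A` and `Y` costs a factor at most `#(A A⁻¹) / c`. -/
lemma card_mul_mul_mul_le [Group G] [DecidableEq G] {A S Y : Finset G} {c : ℕ}
    (hS : ∀ s ∈ S, c ≤ #{y ∈ A | y * s ∈ A}) :
    c * #(A * (S * Y)) ≤ #(A * A⁻¹) * #(A * Y) := by
  rw [← card_product]
  refine (mul_card_image_le_card_of_maps_to (f := fun w : G × G => w.1 * w.2)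
    (s := {w ∈ (A * A⁻¹) ×ˢ (A * Y) | w.1 * w.2 ∈ A * (S * Y)}) (fun w hw => (mem_filter.1 hw).2)
    c ?_).trans (card_filter_le _ _)
  intro b hb
  obtain ⟨a, ha, t, ht, rfl⟩ := mem_mul.1 hb
  obtain ⟨s, hs, y, hy, rfl⟩ := mem_mul.1 ht
  refine (hS s hs).trans (card_le_card_of_injOn (fun u => (a * u⁻¹, u * s * y)) ?_ ?_)
  · intro u hu
    have hu := mem_filter.1 hu
    have h : a * u⁻¹ * (u * s * y) = a * (s * y) := by group
    rw [mem_coe, mem_filter, mem_filter, mem_product]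
    refine ⟨⟨⟨mul_mem_mul ha (inv_mem_inv hu.1), mul_mem_mul hu.2 hy⟩, ?_⟩, h⟩
    rw [h]; exact hb
  · intro u _ v _ huv
    simpa using congrArg Prod.fst huv

/-- The multiplicative energy of `f` computed through left and through right quotients. -/
lemma sum_sq_corr_eq [Group G] [Fintype G] (f : G → ℝ) :
    ∑ x, (∑ y, f y * f (y * x)) ^ 2 = ∑ z, (∑ y, f y * f (z * y)) ^ 2 := by
  calc ∑ x, (∑ y, f y * f (y * x)) ^ 2
      = ∑ x, ∑ y, ∑ y', f y * f (y * x) * (f y' * f (y' * x)) := by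
        simp only [sq, sum_mul_sum]
    _ = ∑ y, ∑ y', ∑ x, f y * f (y * x) * (f y' * f (y' * x)) := by
        rw [sum_comm]; exact sum_congr rfl fun y _ => sum_comm
    _ = ∑ y, ∑ y', ∑ x, f y * f x * (f y' * f (y' * (y⁻¹ * x))) := by
        refine sum_congr rfl fun y _ => sum_congr rfl fun y' _ => ?_
        exact Fintype.sum_equiv (Equiv.mulLeft y) _ _ fun x => by simp
    _ = ∑ y, ∑ z, ∑ x, f y * f x * (f (z * y) * f (z * x)) := by
        refine sum_congr rfl fun y _ => ?_
        exact Fintype.sum_equiv (Equiv.mulRight y⁻¹) _ _ fun z => by simp [mul_assoc]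
    _ = ∑ z, ∑ y, ∑ x, f y * f x * (f (z * y) * f (z * x)) := sum_comm
    _ = _ := by
        simp only [sq, sum_mul_sum]
        exact sum_congr rfl fun z _ => sum_congr rfl fun y _ => sum_congr rfl fun x _ => by ring

lemma sum_corr [Group G] [Fintype G] (f g : G → ℝ) :
    ∑ x, ∑ y, f y * g (y * x) = (∑ y, f y) * ∑ y, g y := by
  rw [sum_comm, sum_mul]
  refine sum_congr rfl fun y _ => ?_
  rw [← mul_sum, Fintype.sum_equiv (Equiv.mulLeft y) (fun x => g (y * x)) g fun x => by simp]

lemma sum_indicator_mul_indicator [Fintype G] [DecidableEq G] (A : Finset G) (e : G → G) :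
    ∑ y, (if y ∈ A then (1 : ℝ) else 0) * (if e y ∈ A then (1 : ℝ) else 0)
      = #{y ∈ A | e y ∈ A} := by
  rw [card_filter, Nat.cast_sum, ← sum_filter_add_sum_filter_not univ (· ∈ A)]
  simp +contextual [← ite_and]

/-- A set with `#(A A⁻¹) ≤ L #A` controls an approximate subgroup `S`. -/
lemma exists_approximate_subgroup [Group G] [Fintype G] [DecidableEq G]
    {A : Finset G} (hA : A.Nonempty) {L : ℝ} (hL : 1 ≤ L)
    (h : (#(A * A⁻¹) : ℝ) ≤ L * #A) :
    ∃ S : Finset G, 1 ∈ S ∧ (∀ s ∈ S, s⁻¹ ∈ S) ∧ (#A : ℝ) ≤ 2 * L * #S ∧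
      (#S : ℝ) ≤ 2 * L * #A ∧ ∀ n : ℕ, (#(A * S ^ n) : ℝ) ≤ (2 * L ^ 2) ^ n * #A := by
  have hA0 : (0 : ℝ) < #A := by exact_mod_cast hA.card_pos
  set r : G → ℝ := fun x => (#{y ∈ A | y * x ∈ A} : ℝ) with hr
  set f : G → ℝ := fun y => if y ∈ A then (1 : ℝ) else 0 with hf
  have hfr : ∀ x, ∑ y, f y * f (y * x) = r x := fun x => sum_indicator_mul_indicator A (· * x)
  have hfs : ∑ y, f y = #A := by simp [hf]
  have hr0 : ∀ x, 0 ≤ r x := fun x => Nat.cast_nonneg _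
  have hrA : ∀ x, r x ≤ #A := fun x => Nat.cast_le.2 (card_filter_le _ _)
  have hrsum : ∑ x, r x = (#A : ℝ) ^ 2 := by
    simp only [← hfr, sum_corr, hfs, sq]
  have hrsq : (#A : ℝ) ^ 3 ≤ L * ∑ x, r x ^ 2 := by
    have h1 : ∑ x, r x ^ 2 = ∑ z, (∑ y, f y * f (z * y)) ^ 2 := by
      simp only [← hfr, sum_sq_corr_eq]
    have h2 : ∑ z ∈ A * A⁻¹, ∑ y, f y * f (z * y) = (#A : ℝ) ^ 2 := by
      rw [sum_subset (subset_univ _), sum_comm]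
      · have : ∀ y, ∑ z, f y * f (z * y) = f y * #A := fun y => by
          rw [← mul_sum, Fintype.sum_equiv (Equiv.mulRight y) _ f fun z => by simp, hfs]
        simp only [this, ← sum_mul, hfs, sq]
      · intro z _ hz
        refine sum_eq_zero fun y _ => ?_
        by_contra hne
        have h3 : y ∈ A := by by_contra h; simp [hf, h] at hne
        have h4 : z * y ∈ A := by by_contra h; simp [hf, h] at hne
        exact hz (mem_mul.2 ⟨z * y, h4, y⁻¹, inv_mem_inv h3, by group⟩)
    have h3 := sq_sum_le_card_mul_sum_sq (s := A * A⁻¹) (f := fun z => ∑ y, f y * f (z * y))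
    rw [h2] at h3
    have h4 : ∑ z ∈ A * A⁻¹, (∑ y, f y * f (z * y)) ^ 2 ≤ ∑ x, r x ^ 2 := by
      rw [h1]; exact sum_le_sum_of_subset_of_nonneg (subset_univ _) fun _ _ _ => sq_nonneg _
    have h5 : (0 : ℝ) ≤ ∑ x, r x ^ 2 := sum_nonneg fun _ _ => sq_nonneg _
    have h6 : ((#A : ℝ) ^ 2) ^ 2 ≤ L * #A * ∑ x, r x ^ 2 :=
      h3.trans (mul_le_mul h h4 (sum_nonneg fun _ _ => sq_nonneg _) (by positivity))
    nlinarith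
  set S : Finset G := {x | (#A : ℝ) ≤ 2 * L * r x} with hSdef
  have memS : ∀ x, x ∈ S ↔ (#A : ℝ) ≤ 2 * L * r x := fun x => by simp [hSdef]
  refine ⟨S, ?_, ?_, ?_, ?_, ?_⟩
  · rw [memS]
    have : r 1 = #A := by simp [hr, filter_true_of_mem]
    rw [this]; nlinarith
  · intro s hs
    rw [memS] at hs ⊢
    convert hs using 2
    simp only [hr, Nat.cast_inj]
    refine card_bij (fun y _ => y * s⁻¹) ?_ ?_ ?_
    · intro y hy; simpa [and_comm] using hy
    · intro y _ z _; simp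
    · intro y hy; exact ⟨y * s, by simpa [and_comm] using hy, by simp⟩
  · have h1 : ∑ x, r x ^ 2 ≤ #S * (#A : ℝ) ^ 2 + (#A / (2 * L)) * (#A : ℝ) ^ 2 := by
      rw [← sum_filter_add_sum_filter_not univ (· ∈ S)]
      refine add_le_add ?_ ?_
      · rw [filter_mem_eq_inter, univ_inter, ← nsmul_eq_mul]
        exact sum_le_card_nsmul _ _ _ fun x _ => pow_le_pow_left₀ (hr0 x) (hrA x) 2
      · rw [← hrsum, mul_sum]
        refine (sum_le_sum (g := fun x => #A / (2 * L) * r x) ?_).trans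
          (sum_le_sum_of_subset_of_nonneg (subset_univ _) fun x _ _ =>
            mul_nonneg (by positivity) (hr0 x))
        intro x hx
        have hx := (mem_filter.1 hx).2
        rw [memS, not_le] at hx
        rw [sq]
        refine mul_le_mul_of_nonneg_right ?_ (hr0 x)
        rw [le_div_iff₀ (by positivity)]; linarith
    have h2 : (#A / (2 * L)) * (#A : ℝ) ^ 2 * L = (#A : ℝ) ^ 3 / 2 := by field_simp
    have h3 : (#A : ℝ) ^ 3 ≤ L * (#S * (#A : ℝ) ^ 2) + (#A : ℝ) ^ 3 / 2 := by
      nlinarith [mul_le_mul_of_nonneg_left h1 (zero_le_one.trans hL)]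
    have h4 : (#A : ℝ) ^ 2 * #A ≤ (#A : ℝ) ^ 2 * (2 * L * #S) := by nlinarith
    exact le_of_mul_le_mul_left h4 (by positivity)
  · have h1 : ∑ x ∈ S, (#A : ℝ) ≤ ∑ x, 2 * L * r x :=
      (sum_le_sum fun x hx => (memS x).1 hx).trans
        (sum_le_sum_of_subset_of_nonneg (subset_univ _) fun x _ _ =>
          mul_nonneg (by positivity) (hr0 x))
    rw [← mul_sum, hrsum, sum_const, nsmul_eq_mul] at h1
    nlinarith
  · intro n
    induction n with
    | zero => simp
    | succ n ih =>
      have h1 := card_mul_mul_mul_le (A := A) (S := S) (Y := S ^ n) (c := ⌈(#A : ℝ) / (2 * L)⌉₊)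
        fun s hs => by
          rw [Nat.ceil_le, div_le_iff₀ (by positivity)]
          have := (memS s).1 hs
          simp only [hr] at this
          linarith
      rw [← pow_succ'] at h1
      have h2 : (#A : ℝ) / (2 * L) * #(A * S ^ (n + 1)) ≤ #(A * A⁻¹) * #(A * S ^ n) :=
        (mul_le_mul_of_nonneg_right (Nat.le_ceil _) (Nat.cast_nonneg _)).trans
          (by exact_mod_cast h1)
      have h3 : (#A : ℝ) * #(A * S ^ (n + 1)) ≤ #A * ((2 * L ^ 2) ^ (n + 1) * #A) := by
        calc (#A : ℝ) * #(A * S ^ (n + 1)) = 2 * L * (#A / (2 * L) * #(A * S ^ (n + 1))) := by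
              field_simp
          _ ≤ 2 * L * (L * #A * ((2 * L ^ 2) ^ n * #A)) := by
              refine mul_le_mul_of_nonneg_left (h2.trans ?_) (by positivity)
              exact mul_le_mul h ih (by positivity) (by positivity)
          _ = _ := by ring
      exact le_of_mul_le_mul_left h3 hA0

end ApproximateSubgroups

section BalogSzemerediGowers

open scoped Pointwise

variable {G : Type*} [Group G] [Fintype G]

lemma corr_inv (f : G → ℝ) (x : G) : ∑ y, f y * f (y * x⁻¹) = ∑ y, f y * f (y * x) :=
  (Fintype.sum_equiv (Equiv.mulRight x) _ _ fun y => by simp [mul_comm]).symm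

lemma corr_le_sum_sq (f : G → ℝ) (x : G) : ∑ y, f y * f (y * x) ≤ ∑ y, f y ^ 2 := by
  have h : ∑ y, f (y * x) ^ 2 = ∑ y, f y ^ 2 :=
    Fintype.sum_equiv (Equiv.mulRight x) _ _ fun y => rfl
  have : ∑ y, f y * f (y * x) ≤ ∑ y, (f y ^ 2 + f (y * x) ^ 2) / 2 :=
    sum_le_sum fun y _ => by nlinarith [sq_nonneg (f y - f (y * x))]
  rw [← sum_div, sum_add_distrib, h] at this
  linarith

lemma sum_translate_mul_translate (f : G → ℝ) (a b : G) :
    ∑ x, f (x⁻¹ * a) * f (x⁻¹ * b) = ∑ y, f y * f (y * (a⁻¹ * b)) :=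
  Fintype.sum_equiv ((Equiv.inv G).trans (Equiv.mulRight a)) _ _ fun x => by simp [mul_assoc]

set_option maxHeartbeats 1000000 in
/-- A weighted Balog–Szemerédi–Gowers lemma: if the energy of a probability measure `ν` is at
least a proportion `1 / K` of its trivial upper bound, then a translate of `ν` charges a set `B`
of size comparable to `1 / ∑ ν ^ 2` for which `B⁻¹ B` is not much larger. -/
lemma exists_small_inv_mul [DecidableEq G] (ν : G → ℝ) (h0 : ∀ x, 0 ≤ ν x) (h1 : ∑ x, ν x = 1)
    {K : ℝ} (hK : 1 ≤ K)
    (hE : ∑ x, ν x ^ 2 ≤ K * ∑ x, (∑ y, ν y * ν (y * x)) ^ 2) :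
    ∃ (B : Finset G) (g : G), (#(B⁻¹ * B) : ℝ) * (∑ x, ν x ^ 2) ≤ 2 ^ 24 * K ^ 6 ∧
      1 ≤ 2 ^ 12 * K ^ 4 * (∑ x, ν x ^ 2) * #B ∧ 1 ≤ 64 * K ^ 2 * ∑ b ∈ B, ν (g * b) := by
  set s := ∑ x, ν x ^ 2 with hs
  set r : G → ℝ := fun x => ∑ y, ν y * ν (y * x) with hr
  have hK0 : 0 < K := zero_lt_one.trans_le hK
  have hs0 : 0 < s := by
    refine lt_of_le_of_ne (sum_nonneg fun _ _ => sq_nonneg _) fun h => ?_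
    have h2 : ∀ x, ν x = 0 := fun x => by
      have := (sum_eq_zero_iff_of_nonneg fun x _ => sq_nonneg (ν x)).1 h.symm x (mem_univ x)
      simpa using this
    simp [h2] at h1
  have hr0 : ∀ x, 0 ≤ r x := fun x => sum_nonneg fun y _ => mul_nonneg (h0 _) (h0 _)
  have hrs : ∀ x, r x ≤ s := corr_le_sum_sq ν
  have hrsum : ∑ x, r x = 1 := by simp only [hr, sum_corr, h1, mul_one]
  have hrinv : ∀ x, r x⁻¹ = r x := corr_inv ν
  set f : G → ℝ := fun a => if ν a ≤ 4 * K * s then ν a else 0 with hf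
  have hf0 : ∀ a, 0 ≤ f a := fun a => by simp only [hf]; split_ifs; exacts [h0 a, le_rfl]
  have hfν : ∀ a, f a ≤ ν a := fun a => by simp only [hf]; split_ifs; exacts [le_rfl, h0 a]
  have hfM : ∀ a, f a ≤ 4 * K * s := fun a => by
    simp only [hf]; split_ifs with h; exacts [h, by positivity]
  have hfsum : ∑ a, f a ≤ 1 := h1 ▸ sum_le_sum fun a _ => hfν a
  have hlarge : 4 * K * (∑ a, (ν a - f a)) ≤ 1 := by
    have : 4 * K * s * ∑ a, (ν a - f a) ≤ s := by
      rw [mul_sum, hs]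
      refine sum_le_sum fun a _ => ?_
      simp only [hf]
      split_ifs with h
      · simp [sq_nonneg]
      · nlinarith [h0 a]
    nlinarith
  -- the energy of the truncation
  have hQ : s ≤ 2 * K * ∑ a, ∑ b, f a * f b * r (a⁻¹ * b) := by
    have e1 : ∑ a, ∑ b, ν a * ν b * r (a⁻¹ * b) = ∑ x, r x ^ 2 := by
      calc ∑ a, ∑ b, ν a * ν b * r (a⁻¹ * b) = ∑ a, ∑ y, ν a * ν (a * y) * r y :=
            sum_congr rfl fun a _ =>
              Fintype.sum_equiv (Equiv.mulLeft a⁻¹) _ _ fun b => by simp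
        _ = _ := by
            rw [sum_comm]
            exact sum_congr rfl fun y _ => by rw [← sum_mul, sq]
    have e2 : ∑ a, ∑ b, ν a * ν b * r (a⁻¹ * b) ≤ ∑ a, ∑ b, f a * f b * r (a⁻¹ * b) +
        ∑ a, ∑ b, ((ν a - f a) * ν b * s + ν a * (ν b - f b) * s) := by
      simp only [← sum_add_distrib]
      refine sum_le_sum fun a _ => sum_le_sum fun b _ => ?_
      have ha := sub_nonneg.2 (hfν a)
      have hb := sub_nonneg.2 (hfν b)
      have i1 := mul_le_mul_of_nonneg_left (hrs (a⁻¹ * b)) (mul_nonneg ha (h0 b))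
      have i2 := mul_le_mul_of_nonneg_left (hrs (a⁻¹ * b)) (mul_nonneg (h0 a) hb)
      have i3 := mul_nonneg (mul_nonneg ha hb) (hr0 (a⁻¹ * b))
      nlinarith
    have e3 : ∑ a, ∑ b, ((ν a - f a) * ν b * s + ν a * (ν b - f b) * s) =
        2 * s * ∑ a, (ν a - f a) := by
      simp only [sum_add_distrib, ← sum_mul, ← mul_sum, h1]; ring
    rw [e1] at e2
    nlinarith
  set w : G → G → ℝ := fun x a => f a * ν (x⁻¹ * a) with hw
  have hw0 : ∀ x a, 0 ≤ w x a := fun x a => mul_nonneg (hf0 a) (h0 _)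
  set P : Finset G := {y | s ≤ 64 * K * r y} with hP
  have memP : ∀ y, y ∈ P ↔ s ≤ 64 * K * r y := fun y => by simp [hP]
  have hww : ∀ a b, ∑ x, w x a * w x b = f a * f b * r (a⁻¹ * b) := fun a b => by
    simp only [hr, ← sum_translate_mul_translate, mul_sum]
    exact sum_congr rfl fun x _ => by simp only [hw]; ring
  have hW1 : ∑ x, ∑ a, w x a ≤ 1 := by
    rw [sum_comm]
    refine le_trans (le_of_eq (sum_congr rfl fun a _ => ?_)) hfsum
    rw [← mul_sum, Fintype.sum_equiv ((Equiv.inv G).trans (Equiv.mulRight a)) _ ν fun x => by simp,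
      h1, mul_one]
  have hW2 : ∑ x, (∑ a, w x a) ^ 2 = ∑ a, ∑ b, f a * f b * r (a⁻¹ * b) := by
    simp only [sq, sum_mul_sum, ← hww]
    rw [sum_comm]; exact sum_congr rfl fun a _ => sum_comm
  have hbad : 64 * K * ∑ x, ∑ a, ∑ b, (if a⁻¹ * b ∈ P then 0 else w x a * w x b) ≤ s := by
    have e1 : ∑ x, ∑ a, ∑ b, (if a⁻¹ * b ∈ P then 0 else w x a * w x b) =
        ∑ a, ∑ b, (if a⁻¹ * b ∈ P then 0 else f a * f b * r (a⁻¹ * b)) := by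
      rw [sum_comm]; refine sum_congr rfl fun a _ => ?_
      rw [sum_comm]; refine sum_congr rfl fun b _ => ?_
      split_ifs <;> simp [hww]
    have e2 : ∑ a, ∑ b, f a * f b * s = (∑ a, f a) * (∑ a, f a) * s := by
      rw [sum_mul_sum]; simp only [sum_mul]
    have e3 : 64 * K * ∑ a, ∑ b, (if a⁻¹ * b ∈ P then 0 else f a * f b * r (a⁻¹ * b)) ≤
        ∑ a, ∑ b, f a * f b * s := by
      simp only [mul_sum]
      refine sum_le_sum fun a _ => sum_le_sum fun b _ => ?_
      have hab := mul_nonneg (hf0 a) (hf0 b)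
      split_ifs with h
      · rw [mul_zero]; positivity
      · rw [memP, not_le] at h
        nlinarith
    have e4 : (∑ a, f a) * (∑ a, f a) ≤ 1 := mul_le_one₀ hfsum (sum_nonneg fun a _ => hf0 a) hfsum
    rw [e1]; rw [e2] at e3
    nlinarith
  obtain ⟨x, hx⟩ : ∃ x, 0 < 8 * K * (∑ a, w x a) ^ 2 -
      128 * K * ∑ a, ∑ b, (if a⁻¹ * b ∈ P then 0 else w x a * w x b) - s * ∑ a, w x a := by
    by_contra! hcon
    have := sum_nonpos fun x (_ : x ∈ univ) => hcon x
    rw [sum_sub_distrib, sum_sub_distrib, ← mul_sum, ← mul_sum, ← mul_sum, hW2] at this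
    nlinarith
  set W := ∑ a, w x a with hWdef
  set bd := ∑ a, ∑ b, (if a⁻¹ * b ∈ P then 0 else w x a * w x b) with hbd
  have hbd0 : 0 ≤ bd := sum_nonneg fun a _ => sum_nonneg fun b _ => by
    split_ifs; exacts [le_rfl, mul_nonneg (hw0 _ _) (hw0 _ _)]
  have hW0 : 0 ≤ W := sum_nonneg fun a _ => hw0 x a
  have hWpos : 0 < W := by
    refine lt_of_le_of_ne hW0 fun h => ?_
    rw [← h] at hx
    nlinarith
  have hWs : s ≤ 8 * K * W := by
    have : 0 ≤ W * (8 * K * W - s) := by nlinarith [mul_nonneg hK0.le hbd0]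
    nlinarith [nonneg_of_mul_nonneg_right this hWpos]
  have hWbd : 16 * bd ≤ W ^ 2 := by
    have : 0 ≤ K * (W ^ 2 - 16 * bd) := by nlinarith [mul_nonneg hs0.le hW0]
    nlinarith [nonneg_of_mul_nonneg_right this hK0]
  -- sets carrying half of the weight are large
  have half : ∀ Y : Finset G, W / 2 ≤ ∑ a ∈ Y, w x a →
      1 ≤ 64 * K ^ 2 * ∑ a ∈ Y, ν (x⁻¹ * a) ∧ 1 ≤ 2 ^ 12 * K ^ 4 * s * #Y := by
    intro Y hY
    have e1 : ∑ a ∈ Y, w x a ≤ 4 * K * s * ∑ a ∈ Y, ν (x⁻¹ * a) := by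
      rw [mul_sum]
      exact sum_le_sum fun a _ => mul_le_mul_of_nonneg_right (hfM a) (h0 _)
    have e2 : 1 ≤ 64 * K ^ 2 * ∑ a ∈ Y, ν (x⁻¹ * a) := by
      have : s * 1 ≤ s * (64 * K ^ 2 * ∑ a ∈ Y, ν (x⁻¹ * a)) := by nlinarith
      exact le_of_mul_le_mul_left this hs0
    refine ⟨e2, ?_⟩
    have e3 := sq_sum_le_card_mul_sum_sq (s := Y) (f := fun a => ν (x⁻¹ * a))
    have e4 : ∑ a ∈ Y, ν (x⁻¹ * a) ^ 2 ≤ s := by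
      rw [hs, ← Fintype.sum_equiv (Equiv.mulLeft x⁻¹) (fun a => ν (x⁻¹ * a) ^ 2) _ fun a => rfl]
      exact sum_le_sum_of_subset_of_nonneg (subset_univ _) fun _ _ _ => sq_nonneg _
    have e5 : (∑ a ∈ Y, ν (x⁻¹ * a)) ^ 2 ≤ #Y * s :=
      e3.trans (mul_le_mul_of_nonneg_left e4 (Nat.cast_nonneg _))
    calc (1 : ℝ) ≤ (64 * K ^ 2 * ∑ a ∈ Y, ν (x⁻¹ * a)) ^ 2 := one_le_pow₀ e2
      _ = 2 ^ 12 * K ^ 4 * (∑ a ∈ Y, ν (x⁻¹ * a)) ^ 2 := by ring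
      _ ≤ 2 ^ 12 * K ^ 4 * (#Y * s) := mul_le_mul_of_nonneg_left e5 (by positivity)
      _ = _ := by ring
  set B : Finset G := {a | ∑ b, (if a⁻¹ * b ∈ P then 0 else w x b) ≤ W / 4} with hB
  have memB : ∀ a, a ∈ B ↔ ∑ b, (if a⁻¹ * b ∈ P then 0 else w x b) ≤ W / 4 := fun a => by
    simp [hB]
  have hBw : W / 2 ≤ ∑ a ∈ B, w x a := by
    have e1 : ∑ a with a ∉ B, w x a * (W / 4) ≤ bd := by
      refine (sum_le_sum (g := fun a => ∑ b, (if a⁻¹ * b ∈ P then 0 else w x a * w x b)) ?_).trans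
        (sum_le_sum_of_subset_of_nonneg (subset_univ _) fun a _ _ => sum_nonneg fun b _ => ?_)
      · intro a ha
        have ha := (mem_filter.1 ha).2
        rw [memB, not_le] at ha
        refine (mul_le_mul_of_nonneg_left ha.le (hw0 x a)).trans (le_of_eq ?_)
        rw [mul_sum]; exact sum_congr rfl fun b _ => by split_ifs <;> simp
      · split_ifs; exacts [le_rfl, mul_nonneg (hw0 _ _) (hw0 _ _)]
    have e2 : W = ∑ a ∈ B, w x a + ∑ a with a ∉ B, w x a := by
      rw [hWdef, ← sum_filter_add_sum_filter_not univ (· ∈ B), filter_mem_eq_inter, univ_inter]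
    rw [← sum_mul] at e1
    nlinarith
  have hPcard : (#P : ℝ) * s ≤ 64 * K := by
    rw [← mul_one (64 * K), ← hrsum, ← nsmul_eq_mul, mul_sum]
    refine (card_nsmul_le_sum P (fun y => 64 * K * r y) s fun y hy => (memP y).1 hy).trans ?_
    exact sum_le_sum_of_subset_of_nonneg (subset_univ _) fun y _ _ =>
      mul_nonneg (by positivity) (hr0 y)
  refine ⟨B, x⁻¹, ?_, (half B hBw).2, (half B hBw).1⟩
  have hcount : ⌈1 / (2 ^ 12 * K ^ 4 * s)⌉₊ * #(B⁻¹ * B) ≤ #P * #P := by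
    rw [← card_product]
    refine (mul_card_image_le_card_of_maps_to (f := fun v : G × G => v.1 * v.2)
      (s := {v ∈ P ×ˢ P | v.1 * v.2 ∈ B⁻¹ * B}) (fun v hv => (mem_filter.1 hv).2) _ ?_).trans
      (card_filter_le _ _)
    intro z hz
    obtain ⟨a', ha', a₂, ha₂, rfl⟩ := mem_mul.1 hz
    obtain ⟨a₁, ha₁, rfl⟩ := mem_inv.1 ha'
    have hgood : W / 2 ≤ ∑ b with a₁⁻¹ * b ∈ P ∧ a₂⁻¹ * b ∈ P, w x b := by
      have e1 : W ≤ (∑ b with a₁⁻¹ * b ∈ P ∧ a₂⁻¹ * b ∈ P, w x b) +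
          ((∑ b, if a₁⁻¹ * b ∈ P then 0 else w x b) + ∑ b, if a₂⁻¹ * b ∈ P then 0 else w x b) := by
        rw [hWdef, sum_filter, ← sum_add_distrib, ← sum_add_distrib]
        refine sum_le_sum fun b _ => ?_
        have := hw0 x b
        by_cases h₁ : a₁⁻¹ * b ∈ P <;> by_cases h₂ : a₂⁻¹ * b ∈ P <;> simp [h₁, h₂, this]
      linarith [(memB a₁).1 ha₁, (memB a₂).1 ha₂]
    have e2 := (half _ hgood).2
    refine (Nat.ceil_le.2 (by rw [div_le_iff₀ (by positivity)]; linarith)).trans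
      (card_le_card_of_injOn (fun b => (a₁⁻¹ * b, b⁻¹ * a₂)) ?_ ?_)
    · intro b hb
      have hb := (mem_filter.1 hb).2
      have h2 : b⁻¹ * a₂ ∈ P := by
        rw [memP, ← hrinv]; simpa [memP] using hb.2
      have h3 : a₁⁻¹ * b * (b⁻¹ * a₂) = a₁⁻¹ * a₂ := by group
      rw [mem_coe, mem_filter, mem_filter, mem_product]
      exact ⟨⟨⟨hb.1, h2⟩, by rw [h3]; exact hz⟩, h3⟩
    · intro b _ c _ hbc
      exact mul_left_cancel (congrArg Prod.fst hbc)
  have hceil : 1 / (2 ^ 12 * K ^ 4 * s) * #(B⁻¹ * B) ≤ (#P : ℝ) * #P :=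
    (mul_le_mul_of_nonneg_right (Nat.le_ceil _) (Nat.cast_nonneg _)).trans
      (by exact_mod_cast hcount)
  rw [div_mul_eq_mul_div, div_le_iff₀ (by positivity), one_mul] at hceil
  calc (#(B⁻¹ * B) : ℝ) * s ≤ (#P * #P * (2 ^ 12 * K ^ 4 * s)) * s :=
        mul_le_mul_of_nonneg_right hceil hs0.le
    _ = (#P * s) * (#P * s) * (2 ^ 12 * K ^ 4) := by ring
    _ ≤ (64 * K) * (64 * K) * (2 ^ 12 * K ^ 4) := by gcongr
    _ = _ := by ring

end BalogSzemerediGowers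

section Generation

open scoped Pointwise

variable {G : Type*} [Group G] [Fintype G] [DecidableEq G]

/-- If `A` and `A S` have comparable sizes, `A⁻¹ = B` meets few right cosets of the subgroup
generated by `S`; so a measure which is small on cosets of proper subgroups is small on `B`,
unless `S` generates. -/
lemma card_mul_sum_le_of_closure_ne_top {ν : G → ℝ} (h0 : ∀ x, 0 ≤ ν x) {η : ℝ}
    (hη : ∀ H : Subgroup G, H ≠ ⊤ → ∀ a, ∑ x with a⁻¹ * x ∈ H, ν x ≤ η)
    {B S : Finset G} (hS : Subgroup.closure (S : Set G) ≠ ⊤) (g : G) (hη0 : 0 ≤ η) :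
    #S * ∑ b ∈ B, ν (g * b) ≤ #(B⁻¹ * S) * η := by
  set H := Subgroup.closure (S : Set G) with hH
  set T : Finset (G ⧸ H) := B⁻¹.image (fun a : G => (a : G ⧸ H)) with hT
  have hcard : #S * #T ≤ #(B⁻¹ * S) := by
    refine mul_card_image_le_card_of_maps_to (f := fun a : G => (a : G ⧸ H)) ?_ _ ?_
    · intro x hx
      obtain ⟨a, ha, y, hy, rfl⟩ := mem_mul.1 hx
      refine mem_image.2 ⟨a, ha, ?_⟩
      rw [QuotientGroup.eq]
      simpa using Subgroup.subset_closure (mem_coe.2 hy)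
    · intro t ht
      obtain ⟨a, ha, rfl⟩ := mem_image.1 ht
      refine card_le_card_of_injOn (fun y => a * y) ?_ fun y _ z _ h => mul_left_cancel h
      intro y hy
      rw [mem_coe, mem_filter]
      refine ⟨mul_mem_mul ha hy, ?_⟩
      rw [eq_comm, QuotientGroup.eq]
      simpa using Subgroup.subset_closure hy
  have hsum : ∑ b ∈ B, ν (g * b) ≤ #T * η := by
    rw [← sum_fiberwise_of_maps_to (t := T) (g := fun b : G => ((b⁻¹ : G) : G ⧸ H))
      fun b hb => mem_image_of_mem _ (inv_mem_inv hb), ← nsmul_eq_mul]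
    refine sum_le_card_nsmul _ _ _ fun t ht => ?_
    obtain ⟨a, ha, rfl⟩ := mem_image.1 ht
    set H' : Subgroup G := H.comap (MulAut.conj a⁻¹).toMonoidHom with hH'
    have hmem : ∀ y, y ∈ H' ↔ a⁻¹ * y * a ∈ H := fun y => by simp [hH', Subgroup.mem_comap]
    have htop : H' ≠ ⊤ := by
      intro h
      refine hS ((Subgroup.eq_top_iff' _).2 fun y => ?_)
      have := (hmem (a * y * a⁻¹)).1 (h ▸ Subgroup.mem_top _)
      simpa [mul_assoc] using this
    refine le_trans ?_ (hη H' htop (g * a⁻¹))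
    rw [← sum_image (s := {b ∈ B | ((b⁻¹ : G) : G ⧸ H) = a}) (g := fun b => g * b) (f := ν)
      fun y _ z _ h => mul_left_cancel h]
    refine sum_le_sum_of_subset_of_nonneg ?_ fun x _ _ => h0 x
    intro x hx
    obtain ⟨b, hb, rfl⟩ := mem_image.1 hx
    have hb := (mem_filter.1 hb).2
    rw [QuotientGroup.eq] at hb
    refine mem_filter.2 ⟨mem_univ _, (hmem _).2 ?_⟩
    have e : a⁻¹ * ((g * a⁻¹)⁻¹ * (g * b)) * a = b⁻¹⁻¹ * a := by group
    rwa [e]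
  calc #S * ∑ b ∈ B, ν (g * b) ≤ #S * (#T * η) := by gcongr
    _ = ((#S * #T : ℕ) : ℝ) * η := by push_cast; ring
    _ ≤ _ := by gcongr

/-- A measure of large energy which is small on cosets of proper subgroups gives rise to a
generating approximate subgroup. -/
lemma exists_generating_approximate_subgroup (ν : G → ℝ) (h0 : ∀ x, 0 ≤ ν x)
    (h1 : ∑ x, ν x = 1) {K L η : ℝ} (hK : 1 ≤ K) (hL : L = 2 ^ 36 * K ^ 10)
    (hE : ∑ x, ν x ^ 2 ≤ K * ∑ x, (∑ y, ν y * ν (y * x)) ^ 2)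
    (hη : ∀ H : Subgroup G, H ≠ ⊤ → ∀ a, ∑ x with a⁻¹ * x ∈ H, ν x ≤ η)
    (hη0 : 0 ≤ η) (hηK : 256 * K ^ 2 * L ^ 3 * η < 1) :
    ∃ S : Finset G, 1 ∈ S ∧ (∀ s ∈ S, s⁻¹ ∈ S) ∧ Subgroup.closure (S : Set G) = ⊤ ∧
      (∀ n : ℕ, (#(S ^ n) : ℝ) ≤ (2 * L ^ 2) ^ n * (2 * L) * #S) ∧
      1 ≤ 2 * L * (2 ^ 12 * K ^ 4) * (∑ x, ν x ^ 2) * #S ∧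
      #S * (∑ x, ν x ^ 2) ≤ 2 * L * (2 ^ 24 * K ^ 6) := by
  obtain ⟨B, g, hB1, hB2, hB3⟩ := exists_small_inv_mul ν h0 h1 hK hE
  set s := ∑ x, ν x ^ 2 with hs
  have hs0 : 0 ≤ s := sum_nonneg fun _ _ => sq_nonneg _
  have hL1 : 1 ≤ L := by
    rw [hL]; nlinarith [one_le_pow₀ hK (n := 10)]
  have hBne : B.Nonempty := by
    rw [nonempty_iff_ne_empty]; rintro rfl; simp at hB3; linarith
  have hBL : (#(B⁻¹ * B⁻¹⁻¹) : ℝ) ≤ L * #B⁻¹ := by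
    rw [inv_inv, card_inv]
    have hspos : 0 < s := by
      refine lt_of_le_of_ne hs0 fun h => ?_
      rw [← h] at hB2; simp at hB2; linarith
    have : (#(B⁻¹ * B) : ℝ) * s ≤ (L * #B) * s := by
      calc _ ≤ 2 ^ 24 * K ^ 6 * 1 := by rw [mul_one]; exact hB1
        _ ≤ 2 ^ 24 * K ^ 6 * (2 ^ 12 * K ^ 4 * s * #B) := by gcongr
        _ = _ := by rw [hL]; ring
    exact le_of_mul_le_mul_right this hspos
  obtain ⟨S, hS1, hSinv, hS2, hS3, hS4⟩ := exists_approximate_subgroup hBne.inv hL1 hBL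
  rw [card_inv] at hS2 hS3 hS4
  refine ⟨S, hS1, hSinv, ?_, ?_, ?_, ?_⟩
  · by_contra hne
    have h5 := card_mul_sum_le_of_closure_ne_top h0 hη hne (B := B) g hη0
    have h6 := hS4 1
    rw [pow_one, pow_one] at h6
    have hSpos : (0 : ℝ) < #S := by exact_mod_cast card_pos.2 ⟨1, hS1⟩
    have h7 : (#S : ℝ) * 1 ≤ #S * (256 * K ^ 2 * L ^ 3 * η) := by
      calc (#S : ℝ) * 1 ≤ #S * (64 * K ^ 2 * ∑ b ∈ B, ν (g * b)) := by gcongr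
        _ = 64 * K ^ 2 * (#S * ∑ b ∈ B, ν (g * b)) := by ring
        _ ≤ 64 * K ^ 2 * (#(B⁻¹ * S) * η) := by gcongr
        _ ≤ 64 * K ^ 2 * ((2 * L ^ 2 * (2 * L * #S)) * η) := by
            gcongr; exact h6.trans (by gcongr)
        _ = _ := by ring
    nlinarith [le_of_mul_le_mul_left h7 hSpos]
  · intro n
    have : (#(S ^ n) : ℝ) ≤ #(B⁻¹ * S ^ n) :=
      Nat.cast_le.2 (card_le_card_mul_left hBne.inv)
    calc _ ≤ _ := this.trans (hS4 n)
      _ ≤ (2 * L ^ 2) ^ n * (2 * L * #S) := by gcongr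
      _ = _ := by ring
  · calc (1 : ℝ) ≤ _ := hB2
      _ ≤ 2 ^ 12 * K ^ 4 * s * (2 * L * #S) := by gcongr
      _ = _ := by ring
  · have : (#B : ℝ) ≤ #(B⁻¹ * B) := Nat.cast_le.2 (card_le_card_mul_left hBne.inv)
    calc #S * s ≤ (2 * L * #(B⁻¹ * B)) * s := by gcongr; exact hS3.trans (by gcongr)
      _ = 2 * L * (#(B⁻¹ * B) * s) := by ring
      _ ≤ _ := by gcongr

end Generation

namespace SL2

open Matrix Matrix.SpecialLinearGroup
open scoped Pointwise

variable {F : Type*} [Field F]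

/-- The trace of an element of `SL₂`. -/
def tr (x : SpecialLinearGroup (Fin 2) F) : F := x 0 0 + x 1 1

lemma det_eq (x : SpecialLinearGroup (Fin 2) F) : x 0 0 * x 1 1 - x 0 1 * x 1 0 = 1 := by
  rw [← Matrix.det_fin_two]; exact x.2

lemma ext_iff₂ {x y : SpecialLinearGroup (Fin 2) F} :
    x = y ↔ x 0 0 = y 0 0 ∧ x 0 1 = y 0 1 ∧ x 1 0 = y 1 0 ∧ x 1 1 = y 1 1 := by
  refine ⟨by rintro rfl; simp, fun h => ?_⟩
  ext i j
  fin_cases i <;> fin_cases j <;> simp [h]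

lemma mul_entry (x y : SpecialLinearGroup (Fin 2) F) (i j : Fin 2) :
    (x * y) i j = x i 0 * y 0 j + x i 1 * y 1 j := by
  simp [Matrix.mul_apply, Fin.sum_univ_two]

lemma inv_entries (x : SpecialLinearGroup (Fin 2) F) :
    x⁻¹ 0 0 = x 1 1 ∧ x⁻¹ 0 1 = -x 0 1 ∧ x⁻¹ 1 0 = -x 1 0 ∧ x⁻¹ 1 1 = x 0 0 := by
  rw [SL2_inv_expl]; simp

lemma inv00 (x : SpecialLinearGroup (Fin 2) F) : x⁻¹ 0 0 = x 1 1 := (inv_entries x).1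
lemma inv01 (x : SpecialLinearGroup (Fin 2) F) : x⁻¹ 0 1 = -x 0 1 := (inv_entries x).2.1
lemma inv10 (x : SpecialLinearGroup (Fin 2) F) : x⁻¹ 1 0 = -x 1 0 := (inv_entries x).2.2.1
lemma inv11 (x : SpecialLinearGroup (Fin 2) F) : x⁻¹ 1 1 = x 0 0 := (inv_entries x).2.2.2

lemma one_entries : (1 : SpecialLinearGroup (Fin 2) F) 0 0 = 1 ∧
    (1 : SpecialLinearGroup (Fin 2) F) 0 1 = 0 ∧ (1 : SpecialLinearGroup (Fin 2) F) 1 0 = 0 ∧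
    (1 : SpecialLinearGroup (Fin 2) F) 1 1 = 1 := by
  simp

lemma tr_conj (a x : SpecialLinearGroup (Fin 2) F) : tr (a * x * a⁻¹) = tr x := by
  simp only [tr, mul_entry, inv00, inv01, inv10, inv11]
  linear_combination (x 0 0 + x 1 1) * det_eq a

lemma tr_inv (x : SpecialLinearGroup (Fin 2) F) : tr x⁻¹ = tr x := by
  simp only [tr, inv00, inv11]; ring

/-- `x` maps the vector `(v, w)` to `c • (v, w)`. -/
def HasEigen (x : SpecialLinearGroup (Fin 2) F) (v w c : F) : Prop :=
  x 0 0 * v + x 0 1 * w = c * v ∧ x 1 0 * v + x 1 1 * w = c * w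

lemma HasEigen.one (v w : F) : HasEigen 1 v w 1 := by simp [HasEigen]

lemma HasEigen.mul {x y : SpecialLinearGroup (Fin 2) F} {v w c d : F} (hx : HasEigen x v w c)
    (hy : HasEigen y v w d) : HasEigen (x * y) v w (c * d) := by
  obtain ⟨h1, h2⟩ := hx
  obtain ⟨h3, h4⟩ := hy
  constructor <;> simp only [mul_entry]
  · linear_combination x 0 0 * h3 + x 0 1 * h4 + d * h1
  · linear_combination x 1 0 * h3 + x 1 1 * h4 + d * h2

lemma HasEigen.ne_zero {x : SpecialLinearGroup (Fin 2) F} {v w c : F} (hx : HasEigen x v w c)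
    (h : v ≠ 0 ∨ w ≠ 0) : c ≠ 0 := by
  rintro rfl
  obtain ⟨h1, h2⟩ := hx
  have hd := det_eq x
  rcases h with h | h
  · exact h (by linear_combination (-v) * hd + x 1 1 * h1 - x 0 1 * h2)
  · exact h (by linear_combination (-w) * hd + x 0 0 * h2 - x 1 0 * h1)

lemma HasEigen.inv {x : SpecialLinearGroup (Fin 2) F} {v w c : F} (hx : HasEigen x v w c)
    (h : v ≠ 0 ∨ w ≠ 0) : HasEigen x⁻¹ v w c⁻¹ := by
  have hc := hx.ne_zero h
  obtain ⟨h1, h2⟩ := hx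
  have hd := det_eq x
  constructor <;> simp only [inv00, inv01, inv10, inv11] <;> field_simp
  · linear_combination v * hd - x 1 1 * h1 + x 0 1 * h2
  · linear_combination w * hd - x 0 0 * h2 + x 1 0 * h1

lemma exists_hasEigen_iff {x : SpecialLinearGroup (Fin 2) F} {v w : F} (h : v ≠ 0 ∨ w ≠ 0) :
    (∃ c, HasEigen x v w c) ↔ w * (x 0 0 * v + x 0 1 * w) = v * (x 1 0 * v + x 1 1 * w) := by
  constructor
  · rintro ⟨c, h1, h2⟩
    rw [h1, h2]; ring
  · intro e
    rcases h with h | h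
    · refine ⟨(x 0 0 * v + x 0 1 * w) / v, by field_simp, ?_⟩
      field_simp; linear_combination -e
    · refine ⟨(x 1 0 * v + x 1 1 * w) / w, ?_, by field_simp⟩
      field_simp; linear_combination e

/-- The eigenvalues of `x` are roots of its characteristic polynomial. -/
lemma HasEigen.charpoly {x : SpecialLinearGroup (Fin 2) F} {v w c : F} (hx : HasEigen x v w c)
    (h : v ≠ 0 ∨ w ≠ 0) : c ^ 2 - tr x * c + 1 = 0 := by
  obtain ⟨h1, h2⟩ := hx
  have hd := det_eq x
  simp only [tr]
  have e1 : (c ^ 2 - (x 0 0 + x 1 1) * c + 1) * v = 0 := by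
    linear_combination (x 1 1 - c) * h1 - x 0 1 * h2 - v * hd
  have e2 : (c ^ 2 - (x 0 0 + x 1 1) * c + 1) * w = 0 := by
    linear_combination (x 0 0 - c) * h2 - x 1 0 * h1 - w * hd
  rcases h with h | h
  · exact (mul_eq_zero.1 e1).resolve_right h
  · exact (mul_eq_zero.1 e2).resolve_right h

/-- No line is invariant under a generating set. -/
lemma exists_mem_not_hasEigen {S : Set (SpecialLinearGroup (Fin 2) F)}
    (hS : Subgroup.closure S = ⊤) {v w : F} (h : v ≠ 0 ∨ w ≠ 0) :
    ∃ a ∈ S, ∀ c, ¬ HasEigen a v w c := by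
  by_contra! hcon
  have all : ∀ x : SpecialLinearGroup (Fin 2) F, ∃ c, HasEigen x v w c := by
    intro x
    have hx : x ∈ Subgroup.closure S := hS ▸ Subgroup.mem_top x
    induction hx using Subgroup.closure_induction with
    | mem x hx => exact hcon x hx
    | one => exact ⟨1, HasEigen.one v w⟩
    | mul x y _ _ hx hy =>
      obtain ⟨c, hc⟩ := hx
      obtain ⟨d, hd⟩ := hy
      exact ⟨c * d, hc.mul hd⟩
    | inv x _ hx =>
      obtain ⟨c, hc⟩ := hx
      exact ⟨c⁻¹, hc.inv h⟩
  have h1 := (exists_hasEigen_iff h).1 (all ⟨!![1, 1; 0, 1], by simp⟩)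
  have h2 := (exists_hasEigen_iff h).1 (all ⟨!![1, 0; 1, 1], by simp⟩)
  simp at h1 h2
  rcases h with h | h
  · apply h; simpa [mul_add, mul_comm] using h2
  · apply h; simpa [mul_add, mul_comm] using h1

lemma eq_one_of_fixes {g : SpecialLinearGroup (Fin 2) F} {v w v' w' : F} (h : HasEigen g v w 1)
    (h' : HasEigen g v' w' 1) (hne : v * w' - w * v' ≠ 0) : g = 1 := by
  obtain ⟨h1, h2⟩ := h
  obtain ⟨h3, h4⟩ := h'
  rw [ext_iff₂]
  simp only [one_entries]
  refine ⟨?_, ?_, ?_, ?_⟩ <;> apply mul_left_cancel₀ hne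
  · linear_combination w' * h1 - w * h3
  · linear_combination v * h3 - v' * h1
  · linear_combination w' * h2 - w * h4
  · linear_combination v * h4 - v' * h2

/-- The elements of `A ^ k` with a prescribed action on a given vector are few. -/
lemma card_hasEigen_sq_le [DecidableEq F] {A : Finset (SpecialLinearGroup (Fin 2) F)}
    (hinv : ∀ a ∈ A, a⁻¹ ∈ A)
    (hA : Subgroup.closure (A : Set (SpecialLinearGroup (Fin 2) F)) = ⊤) {v w : F}
    (h : v ≠ 0 ∨ w ≠ 0) (c : F) (k : ℕ) :
    #{x ∈ A ^ k | HasEigen x v w c} ^ 2 ≤ #(A ^ (2 * k + 2)) := by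
  obtain ⟨a, ha, hav⟩ := exists_mem_not_hasEigen hA h
  have ha' := hinv a (mem_coe.1 ha)
  rw [sq, ← card_product]
  refine card_le_card_of_injOn (fun z => z.1 * a * z.2 * a⁻¹) ?_ ?_
  · rintro ⟨x, y⟩ hxy
    rw [mem_coe, mem_product, mem_filter, mem_filter] at hxy
    have e : 2 * k + 2 = k + 1 + k + 1 := by ring
    rw [mem_coe, e, pow_succ, pow_add, pow_succ]
    exact mul_mem_mul (mul_mem_mul (mul_mem_mul hxy.1.1 ha) hxy.2.1) ha'
  · rintro ⟨x, y⟩ hxy ⟨x', y'⟩ hxy' heq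
    rw [mem_coe, mem_product, mem_filter, mem_filter] at hxy hxy'
    simp only at hxy hxy' heq
    have hc := hxy.1.2.ne_zero h
    have e : x'⁻¹ * x = a * (y' * y⁻¹) * a⁻¹ := by
      have : x = x' * a * y' * a⁻¹ * a * y⁻¹ * a⁻¹ := by rw [← heq]; group
      rw [this]; group
    have f1 : HasEigen (x'⁻¹ * x) v w 1 := by
      simpa [hc] using (hxy'.1.2.inv h).mul hxy.1.2
    have f2 : HasEigen (y' * y⁻¹) v w 1 := by
      simpa [hc] using hxy'.2.2.mul (hxy.2.2.inv h)
    have f3 : HasEigen (x'⁻¹ * x) (a 0 0 * v + a 0 1 * w) (a 1 0 * v + a 1 1 * w) 1 := by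
      obtain ⟨g1, g2⟩ := f2
      have hd := det_eq a
      rw [e]
      constructor <;> simp only [mul_entry, inv00, inv01, inv10, inv11] at g1 g2 ⊢
      · linear_combination a 0 0 * g1 + a 0 1 * g2 +
          (a 0 0 * ((y' 0 0 * y 1 1 + y' 0 1 * -y 1 0) * v +
            (y' 0 0 * -y 0 1 + y' 0 1 * y 0 0) * w) +
          a 0 1 * ((y' 1 0 * y 1 1 + y' 1 1 * -y 1 0) * v +
            (y' 1 0 * -y 0 1 + y' 1 1 * y 0 0) * w)) * hd
      · linear_combination a 1 0 * g1 + a 1 1 * g2 +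
          (a 1 0 * ((y' 0 0 * y 1 1 + y' 0 1 * -y 1 0) * v +
            (y' 0 0 * -y 0 1 + y' 0 1 * y 0 0) * w) +
          a 1 1 * ((y' 1 0 * y 1 1 + y' 1 1 * -y 1 0) * v +
            (y' 1 0 * -y 0 1 + y' 1 1 * y 0 0) * w)) * hd
    have hne : v * (a 1 0 * v + a 1 1 * w) - w * (a 0 0 * v + a 0 1 * w) ≠ 0 := fun h0 => by
      obtain ⟨d, hd⟩ := (exists_hasEigen_iff (x := a) h).2 (by linear_combination -h0)
      exact hav d hd
    have g1 := eq_one_of_fixes f1 f3 hne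
    have hx : x' = x := inv_mul_eq_one.1 g1
    have hy : y' = y := by
      rw [g1] at e
      exact mul_inv_eq_one.1 (by simpa [eq_comm, mul_inv_eq_one] using e)
    rw [hx, hy]

end SL2

namespace SL2

open Matrix Matrix.SpecialLinearGroup
open scoped Pointwise

variable {F : Type*} [Field F]

/-- Two traceless commuting elements anticommute or are proportional. -/
lemma mul_anticomm_of_tr_eq_zero {x y : SpecialLinearGroup (Fin 2) F} (hx : tr x = 0)
    (hy : tr y = 0) (hxy : tr (x * y) = 0) (i j : Fin 2) : (x * y) i j = -(y * x) i j := by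
  simp only [tr, mul_entry] at *
  fin_cases i <;> fin_cases j <;> simp
  · linear_combination hxy + x 0 0 * hy + y 0 0 * hx - (x 0 0 + x 1 1) * hy
  · linear_combination x 0 1 * hy + y 0 1 * hx
  · linear_combination x 1 0 * hy + y 1 0 * hx
  · linear_combination hxy + x 1 1 * hy + y 1 1 * hx - (x 0 0 + x 1 1) * hy

lemma commutator_mem_center {x y : SpecialLinearGroup (Fin 2) F} {e : F}
    (h : ∀ i j, (x * y) i j = e * (y * x) i j) :
    x * y * (y * x)⁻¹ ∈ Subgroup.center (SpecialLinearGroup (Fin 2) F) := by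
  have h00 := h 0 0
  have h01 := h 0 1
  have h10 := h 1 0
  have h11 := h 1 1
  generalize y * x = w at *
  generalize x * y = z at *
  have hd := det_eq w
  rw [Subgroup.mem_center_iff]
  intro g
  have e00 : (z * w⁻¹) 0 0 = e := by
    simp only [mul_entry, inv00, inv10]; rw [h00, h01]; linear_combination e * hd
  have e01 : (z * w⁻¹) 0 1 = 0 := by
    simp only [mul_entry, inv01, inv11]; rw [h00, h01]; ring
  have e10 : (z * w⁻¹) 1 0 = 0 := by
    simp only [mul_entry, inv00, inv10]; rw [h10, h11]; ring
  have e11 : (z * w⁻¹) 1 1 = e := by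
    simp only [mul_entry, inv01, inv11]; rw [h10, h11]; linear_combination e * hd
  rw [ext_iff₂]
  simp only [mul_entry g, mul_entry _ g, e00, e01, e10, e11]
  refine ⟨?_, ?_, ?_, ?_⟩ <;> ring

/-- A generating set does not commute modulo the center. -/
lemma exists_not_mem_center {S : Set (SpecialLinearGroup (Fin 2) F)}
    (hS : Subgroup.closure S = ⊤) :
    ∃ x ∈ S, ∃ y ∈ S, x * y * (y * x)⁻¹ ∉ Subgroup.center (SpecialLinearGroup (Fin 2) F) := by
  by_contra! hcon
  let f := QuotientGroup.mk' (Subgroup.center (SpecialLinearGroup (Fin 2) F))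
  have key : ∀ x y, x * y * (y * x)⁻¹ ∈ Subgroup.center (SpecialLinearGroup (Fin 2) F) ↔
      Commute (f x) (f y) := by
    intro x y
    rw [Commute, SemiconjBy, ← mul_inv_eq_one, ← map_mul, ← map_mul, ← map_inv, ← map_mul,
      ← MonoidHom.mem_ker, QuotientGroup.ker_mk']
  have h1 : ∀ x : SpecialLinearGroup (Fin 2) F, ∀ y ∈ S, Commute (f x) (f y) := by
    intro x y hy
    have hx : x ∈ Subgroup.closure S := hS ▸ Subgroup.mem_top x
    induction hx using Subgroup.closure_induction with
    | mem x hx => exact (key x y).1 (hcon x hx y hy)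
    | one => simp
    | mul x z _ _ hx hz => rw [map_mul]; exact hx.mul_left hz
    | inv x _ hx => rw [map_inv]; exact hx.inv_left
  have h2 : ∀ x y : SpecialLinearGroup (Fin 2) F, Commute (f x) (f y) := by
    intro x y
    have hy : y ∈ Subgroup.closure S := hS ▸ Subgroup.mem_top y
    induction hy using Subgroup.closure_induction with
    | mem y hy => exact h1 x y hy
    | one => simp
    | mul y z _ _ hy hz => rw [map_mul]; exact hy.mul_right hz
    | inv y _ hy => rw [map_inv]; exact hy.inv_right
  let u : SpecialLinearGroup (Fin 2) F := ⟨!![1, 1; 0, 1], by simp⟩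
  let l : SpecialLinearGroup (Fin 2) F := ⟨!![1, 0; 1, 1], by simp⟩
  have hc := Subgroup.mem_center_iff.1 ((key u l).2 (h2 u l)) u
  have hc' := (ext_iff₂.1 hc).1
  simp only [mul_entry, _root_.mul_inv_rev, inv00, inv01, inv10, inv11] at hc'
  simp [u, l] at hc'

lemma exists_eq_rankOne {n b c : F} (h : n ^ 2 + b * c = 0) (hne : b ≠ 0 ∨ c ≠ 0) :
    ∃ v w s : F, (v ≠ 0 ∨ w ≠ 0) ∧ s ≠ 0 ∧ n = s * v * w ∧ b = -s * v ^ 2 ∧ c = s * w ^ 2 := by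
  by_cases hb : b = 0
  · subst hb
    have hn : n = 0 := by simpa using h
    exact ⟨0, 1, c, by simp, by simpa using hne, by simp [hn], by simp, by simp⟩
  · refine ⟨b, -n, -1 / b, by simp [hb], by simp [hb], by field_simp, by field_simp, ?_⟩
    field_simp; linear_combination h

/-- A product of two conjugate unipotent elements (up to sign) with different fixed lines. -/
lemma exists_tr_mul_conj_ne_two (h2 : (2 : F) ≠ 0) {S : Set (SpecialLinearGroup (Fin 2) F)}
    (hS : Subgroup.closure S = ⊤)
    {u : SpecialLinearGroup (Fin 2) F} (ht : tr u ^ 2 = 4) (hu : u 0 1 ≠ 0 ∨ u 1 0 ≠ 0) :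
    ∃ a ∈ S, tr (u * (a * u * a⁻¹)) ≠ 2 := by
  obtain ⟨e, he⟩ : ∃ e, tr u = 2 * e := ⟨tr u / 2, by field_simp⟩
  have he1 : e ^ 2 = 1 := by
    have : 4 * (e ^ 2 - 1) = 0 := by rw [he] at ht; linear_combination ht
    have h4 : (4 : F) ≠ 0 := by
      have : (4 : F) = 2 * 2 := by norm_num
      rw [this]; exact mul_ne_zero h2 h2
    exact sub_eq_zero.1 ((mul_eq_zero.1 this).resolve_left h4)
  have hd := det_eq u
  have h11 : u 1 1 = 2 * e - u 0 0 := by rw [← he, tr]; ring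
  obtain ⟨v, w, s, hvw, hs, hn, hb, hc⟩ :=
    exists_eq_rankOne (n := u 0 0 - e) (b := u 0 1) (c := u 1 0)
      (by rw [h11] at hd; linear_combination -hd + he1) hu
  obtain ⟨a, ha, hav⟩ := exists_mem_not_hasEigen hS hvw
  refine ⟨a, ha, fun h => ?_⟩
  have hne : v * (a 1 0 * v + a 1 1 * w) - w * (a 0 0 * v + a 0 1 * w) ≠ 0 := fun h0 => by
    obtain ⟨d, hd⟩ := (exists_hasEigen_iff (x := a) hvw).2 (by linear_combination -h0)
    exact hav d hd
  have h00 : u 0 0 = e + s * v * w := by linear_combination hn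
  have h11' : u 1 1 = e - s * v * w := by rw [h11, h00]; ring
  have key : tr (u * (a * u * a⁻¹)) - 2
      = -(s * (v * (a 1 0 * v + a 1 1 * w) - w * (a 0 0 * v + a 0 1 * w))) ^ 2 := by
    simp only [tr, mul_entry, inv00, inv01, inv10, inv11]
    rw [h00, h11', hb, hc]
    linear_combination 2 * he1 + 2 * e ^ 2 * det_eq a
  rw [h, sub_self, eq_comm, neg_eq_zero] at key
  exact mul_ne_zero hs hne (pow_eq_zero_iff (two_ne_zero) |>.1 key)

lemma tr_sq_mul (u w : SpecialLinearGroup (Fin 2) F) :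
    tr (u ^ 2 * w) = tr u * tr (u * w) - tr w := by
  simp only [tr, mul_entry, sq]
  linear_combination (-(w 0 0 + w 1 1)) * det_eq u

lemma tr_cube_mul (u w : SpecialLinearGroup (Fin 2) F) :
    tr (u ^ 3 * w) = tr u * tr (u ^ 2 * w) - tr (u * w) := by
  have := tr_sq_mul u (u * w)
  rwa [← mul_assoc, ← pow_succ, ← mul_assoc, ← sq] at this

variable [DecidableEq F]

/-- A generating set quickly produces a regular semisimple element of nonzero trace. -/
lemma exists_regular (h2 : (2 : F) ≠ 0) (h3 : (3 : F) ≠ 0)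
    {A : Finset (SpecialLinearGroup (Fin 2) F)} (h1 : 1 ∈ A) (hinv : ∀ a ∈ A, a⁻¹ ∈ A)
    (hA : Subgroup.closure (A : Set (SpecialLinearGroup (Fin 2) F)) = ⊤) :
    ∃ g ∈ A ^ 10, tr g ≠ 0 ∧ tr g ^ 2 ≠ 4 := by
  by_contra! hcon
  have mono : ∀ {m n : ℕ}, m ≤ n → A ^ m ⊆ A ^ n := fun h => pow_subset_pow_right h1 h
  have h4 : (4 : F) ≠ 0 := by
    have : (4 : F) = 2 * 2 := by norm_num
    rw [this]; exact mul_ne_zero h2 h2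
  by_cases hcase : ∃ u ∈ A ^ 2, tr u ^ 2 = 4 ∧ (u 0 1 ≠ 0 ∨ u 1 0 ≠ 0)
  · obtain ⟨u, hu, ht, hne⟩ := hcase
    obtain ⟨a, ha, hc⟩ := exists_tr_mul_conj_ne_two h2 hA ht hne
    have ha' : a ∈ A := mem_coe.1 ha
    set w := a * u * a⁻¹ with hw
    have hwA : w ∈ A ^ 4 := by
      have : A ^ 4 = A * A ^ 2 * A := by rw [← pow_succ', ← pow_succ]
      rw [this]
      exact mul_mem_mul (mul_mem_mul ha' hu) (hinv a ha')
    have htw : tr w = tr u := tr_conj a u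
    have huu : u ^ 2 ∈ A ^ 4 := by
      rw [show A ^ 4 = (A ^ 2) ^ 2 by rw [← pow_mul]]; exact pow_mem_pow hu
    have huuu : u ^ 3 ∈ A ^ 6 := by
      rw [show A ^ 6 = (A ^ 2) ^ 3 by rw [← pow_mul]]; exact pow_mem_pow hu
    have m1 : u * w ∈ A ^ 10 := mono (show 6 ≤ 10 by norm_num) <| by
      rw [show A ^ 6 = A ^ 2 * A ^ 4 by rw [← pow_add]]; exact mul_mem_mul hu hwA
    have m2 : u ^ 2 * w ∈ A ^ 10 := mono (show 8 ≤ 10 by norm_num) <| by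
      rw [show A ^ 8 = A ^ 4 * A ^ 4 by rw [← pow_add]]; exact mul_mem_mul huu hwA
    have m3 : u ^ 3 * w ∈ A ^ 10 := by
      rw [show A ^ 10 = A ^ 6 * A ^ 4 by rw [← pow_add]]; exact mul_mem_mul huuu hwA
    have k1 := hcon _ m1
    have k2 := hcon _ m2
    have k3 := hcon _ m3
    have r3 := tr_cube_mul u w
    have r2 := tr_sq_mul u w
    rw [htw] at r2
    set c := tr (u * w)
    set t := tr u
    have r3' : tr (u ^ 3 * w) = 3 * c - 4 := by
      rw [r3, r2]; linear_combination (c - 1) * ht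
    rw [r3'] at k3
    rw [r2] at k2
    by_cases hc0 : c = 0
    · rw [hc0] at k3
      have := k3 (by simpa using h4)
      have e : (2 : F) * 2 * 3 = 0 := by linear_combination this
      exact mul_ne_zero (mul_ne_zero h2 h2) h3 e
    · have hc2 : c = -2 := by
        have : (c - 2) * (c + 2) = 0 := by linear_combination k1 hc0
        exact eq_neg_of_add_eq_zero_left ((mul_eq_zero.1 this).resolve_left (sub_ne_zero.2 hc))
      rw [hc2] at k2
      have ht0 : t ≠ 0 := by rintro h0; rw [h0] at ht; exact h4 (by simpa using ht.symm)
      have := k2 (fun h => by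
        have : 3 * t = 0 := by linear_combination -h
        exact mul_ne_zero h3 ht0 this)
      have e : (2 : F) * 2 * 2 * 2 * 2 = 0 := by linear_combination this - 9 * ht
      exact mul_ne_zero (mul_ne_zero (mul_ne_zero (mul_ne_zero h2 h2) h2) h2) h2 e
  · push Not at hcase
    obtain ⟨x, hx, y, hy, hxy⟩ := exists_not_mem_center hA
    have hx2 : x ∈ A ^ 2 := by
      have := mono (show 1 ≤ 2 by norm_num) (show x ∈ A ^ 1 by simpa using hx); exact this
    have hy2 : y ∈ A ^ 2 := by
      have := mono (show 1 ≤ 2 by norm_num) (show y ∈ A ^ 1 by simpa using hy); exact this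
    have hxy2 : x * y ∈ A ^ 2 := by rw [sq]; exact mul_mem_mul hx hy
    have diag : ∀ z ∈ A ^ 2, tr z ≠ 0 → z 0 1 = 0 ∧ z 1 0 = 0 ∧ z 0 0 = z 1 1 := by
      intro z hz h0
      have ht := hcon z (mono (by norm_num) hz) h0
      obtain ⟨g1, g2⟩ := hcase z hz ht
      refine ⟨g1, g2, ?_⟩
      have hd := det_eq z
      rw [g1] at hd
      rw [tr] at ht
      have : (z 0 0 - z 1 1) ^ 2 = 0 := by linear_combination ht - 4 * hd
      exact sub_eq_zero.1 (pow_eq_zero_iff two_ne_zero |>.1 this)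
    apply hxy
    by_cases tx : tr x = 0
    · by_cases ty : tr y = 0
      · by_cases txy : tr (x * y) = 0
        · exact commutator_mem_center (e := -1) fun i j => by
            rw [mul_anticomm_of_tr_eq_zero tx ty txy]; ring
        · obtain ⟨g1, g2, g3⟩ := diag _ hxy2 txy
          rw [show x * y * (y * x)⁻¹ = 1 from ?_]
          · exact one_mem _
          have : x * (x * y) = x * y * x := by
            rw [ext_iff₂]
            simp only [mul_entry x (x * y), mul_entry (x * y) x, g1, g2, g3]
            refine ⟨?_, ?_, ?_, ?_⟩ <;> ring
          rw [mul_inv_eq_one]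
          rw [mul_assoc] at this
          exact mul_left_cancel this
      · obtain ⟨g1, g2, g3⟩ := diag _ hy2 ty
        refine commutator_mem_center (e := 1) fun i j => ?_
        fin_cases i <;> fin_cases j <;> simp [mul_entry, g1, g2, g3, mul_comm]
    · obtain ⟨g1, g2, g3⟩ := diag _ hx2 tx
      refine commutator_mem_center (e := 1) fun i j => ?_
      fin_cases i <;> fin_cases j <;> simp [mul_entry, g1, g2, g3, mul_comm]

end SL2

namespace SL2

open Matrix Matrix.SpecialLinearGroup
open scoped Pointwise

variable {F : Type*} [Field F]

lemma exists_eq_smul_of_minors {a b c a' b' c' : F} (h : ¬(a = 0 ∧ b = 0 ∧ c = 0))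
    (h1 : a * b' = b * a') (h2 : a * c' = c * a') (h3 : b * c' = c * b') :
    ∃ s, a' = s * a ∧ b' = s * b ∧ c' = s * c := by
  by_cases ha : a = 0
  · by_cases hb : b = 0
    · have hc : c ≠ 0 := fun hc => h ⟨ha, hb, hc⟩
      subst ha hb
      refine ⟨c' / c, ?_, ?_, by field_simp⟩
      · simpa [hc] using h2
      · simpa [hc] using h3
    · subst ha
      refine ⟨b' / b, ?_, by field_simp, by field_simp; linear_combination h3⟩
      simpa [hb] using h1
  · exact ⟨a' / a, by field_simp, by field_simp; linear_combination h1,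
      by field_simp; linear_combination h2⟩

lemma minors_of_orthogonal {a b c a' b' c' x y z x' y' z' : F}
    (h : ¬(a * b' = b * a' ∧ a * c' = c * a' ∧ b * c' = c * b'))
    (h1 : a * x + b * y + c * z = 0) (h2 : a' * x + b' * y + c' * z = 0)
    (h3 : a * x' + b * y' + c * z' = 0) (h4 : a' * x' + b' * y' + c' * z' = 0) :
    ∃ β γ : F, ¬(β = 0 ∧ γ = 0) ∧ β * x + γ * x' = 0 ∧ β * y + γ * y' = 0 ∧
      β * z + γ * z' = 0 := by
  have hW : ¬(b * c' - c * b' = 0 ∧ c * a' - a * c' = 0 ∧ a * b' - b * a' = 0) := by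
    rintro ⟨e1, e2, e3⟩
    exact h ⟨sub_eq_zero.1 e3, (sub_eq_zero.1 e2).symm, sub_eq_zero.1 e1⟩
  obtain ⟨s, s1, s2, s3⟩ := exists_eq_smul_of_minors hW (a' := x) (b' := y) (c' := z)
    (by linear_combination c' * h1 - c * h2)
    (by linear_combination b * h2 - b' * h1)
    (by linear_combination a' * h1 - a * h2)
  obtain ⟨r, r1, r2, r3⟩ := exists_eq_smul_of_minors hW (a' := x') (b' := y') (c' := z')
    (by linear_combination c' * h3 - c * h4)
    (by linear_combination b * h4 - b' * h3)
    (by linear_combination a' * h3 - a * h4)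
  by_cases hs : s = 0
  · exact ⟨1, 0, by simp, by simp [s1, hs], by simp [s2, hs], by simp [s3, hs]⟩
  · refine ⟨r, -s, by simp [hs], ?_, ?_, ?_⟩
    · rw [s1, r1]; ring
    · rw [s2, r2]; ring
    · rw [s3, r3]; ring

lemma eq_iff_of_tr_eq {x y : SpecialLinearGroup (Fin 2) F} (h : tr x = tr y) :
    x = y ↔ y 0 0 - x 0 0 = 0 ∧ y 0 1 - x 0 1 = 0 ∧ y 1 0 - x 1 0 = 0 := by
  rw [ext_iff₂]
  constructor
  · rintro ⟨h1, h2, h3, _⟩; simp [h1, h2, h3]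
  · rintro ⟨h1, h2, h3⟩
    refine ⟨(sub_eq_zero.1 h1).symm, (sub_eq_zero.1 h2).symm, (sub_eq_zero.1 h3).symm, ?_⟩
    simp only [tr] at h
    linear_combination h + h1

/-- Three collinear points of equal trace on the quadric `det = 1` differ by a nilpotent matrix
whose kernel is invariant. -/
lemma exists_rankOne_of_collinear {x y z : SpecialLinearGroup (Fin 2) F} (hy : tr x = tr y)
    (hz : tr x = tr z) (hxy : x ≠ y) (hxz : x ≠ z) (hyz : y ≠ z)
    (h : (y 0 0 - x 0 0) * (z 0 1 - x 0 1) = (y 0 1 - x 0 1) * (z 0 0 - x 0 0) ∧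
      (y 0 0 - x 0 0) * (z 1 0 - x 1 0) = (y 1 0 - x 1 0) * (z 0 0 - x 0 0) ∧
      (y 0 1 - x 0 1) * (z 1 0 - x 1 0) = (y 1 0 - x 1 0) * (z 0 1 - x 0 1)) :
    ∃ v w r s : F, (v ≠ 0 ∨ w ≠ 0) ∧ r ≠ 0 ∧ y 0 0 - x 0 0 = r * v * w ∧
      y 0 1 - x 0 1 = -r * v ^ 2 ∧ y 1 0 - x 1 0 = r * w ^ 2 ∧
      z 0 0 - x 0 0 = s * (r * v * w) ∧
      z 0 1 - x 0 1 = s * (-r * v ^ 2) ∧ z 1 0 - x 1 0 = s * (r * w ^ 2) ∧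
      ∃ c, HasEigen x v w c := by
  have hD := mt (eq_iff_of_tr_eq hy).2 hxy
  have hD' := mt (eq_iff_of_tr_eq hz).2 hxz
  have hD'' := mt (eq_iff_of_tr_eq (hy.symm.trans hz)).2 hyz
  obtain ⟨s, s1, s2, s3⟩ := exists_eq_smul_of_minors hD h.1 h.2.1 h.2.2
  have hs : s ≠ 0 := by
    rintro rfl; exact hD' (by simp [s1, s2, s3])
  have hs1 : s - 1 ≠ 0 := by
    intro e
    refine hD'' ⟨?_, ?_, ?_⟩
    · linear_combination s1 + (y 0 0 - x 0 0) * e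
    · linear_combination s2 + (y 0 1 - x 0 1) * e
    · linear_combination s3 + (y 1 0 - x 1 0) * e
  have dx := det_eq x
  have dy := det_eq y
  have dz := det_eq z
  have y11 : y 1 1 = x 1 1 - (y 0 0 - x 0 0) := by simp only [tr] at hy; linear_combination -hy
  have z11 : z 1 1 = x 1 1 - s * (y 0 0 - x 0 0) := by
    simp only [tr] at hz; linear_combination -hz - s1
  have y00 : y 0 0 = x 0 0 + (y 0 0 - x 0 0) := by ring
  have y01 : y 0 1 = x 0 1 + (y 0 1 - x 0 1) := by ring
  have y10 : y 1 0 = x 1 0 + (y 1 0 - x 1 0) := by ring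
  have z00 : z 0 0 = x 0 0 + s * (y 0 0 - x 0 0) := by linear_combination s1
  have z01 : z 0 1 = x 0 1 + s * (y 0 1 - x 0 1) := by linear_combination s2
  have z10 : z 1 0 = x 1 0 + s * (y 1 0 - x 1 0) := by linear_combination s3
  rw [z00, z01, z10, z11] at dz
  rw [y11] at dy
  set n := y 0 0 - x 0 0
  set b := y 0 1 - x 0 1
  set c := y 1 0 - x 1 0
  rw [y00, y01, y10] at dy
  have hdet : n ^ 2 + b * c = 0 := by
    have : s * (s - 1) * (n ^ 2 + b * c) = 0 := by
      linear_combination s * dy - dz + (1 - s) * dx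
    exact (mul_eq_zero.1 this).resolve_left (mul_ne_zero hs hs1)
  have hne : b ≠ 0 ∨ c ≠ 0 := by
    by_contra! hbc
    refine hD ⟨?_, hbc⟩
    rw [hbc.1, zero_mul, add_zero] at hdet
    exact pow_eq_zero_iff two_ne_zero |>.1 hdet
  obtain ⟨v, w, r, hvw, hr, hn, hb, hc⟩ := exists_eq_rankOne hdet hne
  refine ⟨v, w, r, s, hvw, hr, hn, hb, hc, by rw [s1, hn], by rw [s2, hb], by rw [s3, hc],
    (exists_hasEigen_iff hvw).2 ?_⟩
  have : r * (w * (x 0 0 * v + x 0 1 * w)) = r * (v * (x 1 0 * v + x 1 1 * w)) := by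
    rw [hn, hb, hc] at dy
    linear_combination dx - dy
  exact mul_left_cancel₀ hr this

lemma HasEigen.exists_right {x y : SpecialLinearGroup (Fin 2) F} {v w : F} (h : v ≠ 0 ∨ w ≠ 0)
    (hx : ∃ c, HasEigen x v w c) (hxy : ∃ c, HasEigen (x * y) v w c) :
    ∃ c, HasEigen y v w c := by
  obtain ⟨c, hc⟩ := hx
  obtain ⟨d, hd⟩ := hxy
  exact ⟨c⁻¹ * d, by simpa using (hc.inv h).mul hd⟩

lemma tr_inv_mul_eq (x y : SpecialLinearGroup (Fin 2) F) :
    tr (x⁻¹ * y) = x 1 1 * y 0 0 - x 0 1 * y 1 0 - x 1 0 * y 0 1 + x 0 0 * y 1 1 := by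
  simp only [tr, mul_entry, inv00, inv01, inv10, inv11]; ring

/-- The degenerate configurations in the trace-slice estimate. -/
lemma degenerate_of_three_fibre {t : F} (ht : t ≠ 0)
    {x₁ x₂ x₃ x' x'' : SpecialLinearGroup (Fin 2) F}
    (h₁ : tr x₁ = t) (h₂ : tr x₂ = t) (h₃ : tr x₃ = t) (h' : tr x' = t) (h'' : tr x'' = t)
    (h₂' : tr (x'⁻¹ * (x₁ * x₂)) = t) (h₃' : tr (x'⁻¹ * (x₁ * x₃)) = t)
    (h₂'' : tr (x''⁻¹ * (x₁ * x₂)) = t) (h₃'' : tr (x''⁻¹ * (x₁ * x₃)) = t)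
    (n1 : x₁ ≠ x') (n2 : x₁ ≠ x'') (n3 : x' ≠ x'') :
    x₁⁻¹ = x₂ ∨ x₁⁻¹ = x₃ ∨ x₂ = x₃ ∨ ∃ v w : F, (v ≠ 0 ∨ w ≠ 0) ∧ (∃ c, HasEigen x₁ v w c) ∧
      (∃ c, HasEigen x₂ v w c) ∧ ∃ c, HasEigen x₃ v w c := by
  have e2 : tr (x₁⁻¹ * (x₁ * x₂)) = t := by simpa using h₂
  have e3 : tr (x₁⁻¹ * (x₁ * x₃)) = t := by simpa using h₃
  have i2 : x₂ = x₁⁻¹ * (x₁ * x₂) := by simp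
  have i3 : x₃ = x₁⁻¹ * (x₁ * x₃) := by simp
  have t1 : tr x₁ = tr x' := h₁.trans h'.symm
  have t2 : tr x₁ = tr x'' := h₁.trans h''.symm
  have t1' := t1
  have t2' := t2
  rw [tr_inv_mul_eq] at e2 e3 h₂' h₃' h₂'' h₃''
  simp only [tr] at t1' t2'
  by_cases hpar : (x' 0 0 - x₁ 0 0) * (x'' 0 1 - x₁ 0 1) = (x' 0 1 - x₁ 0 1) * (x'' 0 0 - x₁ 0 0) ∧
      (x' 0 0 - x₁ 0 0) * (x'' 1 0 - x₁ 1 0) = (x' 1 0 - x₁ 1 0) * (x'' 0 0 - x₁ 0 0) ∧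
      (x' 0 1 - x₁ 0 1) * (x'' 1 0 - x₁ 1 0) = (x' 1 0 - x₁ 1 0) * (x'' 0 1 - x₁ 0 1)
  · right; right; right
    obtain ⟨v, w, r, s, hvw, hr, hn, hb, hc, -, -, -, hE⟩ :=
      exists_rankOne_of_collinear t1 t2 n1 n2 n3 hpar
    have aux : ∀ y : SpecialLinearGroup (Fin 2) F,
        x₁ 1 1 * y 0 0 - x₁ 0 1 * y 1 0 - x₁ 1 0 * y 0 1 + x₁ 0 0 * y 1 1 = t →
        x' 1 1 * y 0 0 - x' 0 1 * y 1 0 - x' 1 0 * y 0 1 + x' 0 0 * y 1 1 = t →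
        ∃ c, HasEigen y v w c := by
      intro y k1 k2
      refine (exists_hasEigen_iff hvw).2 (mul_left_cancel₀ hr ?_)
      linear_combination k1 - k2 - y 0 0 * t1' + (y 1 1 - y 0 0) * hn - y 1 0 * hb - y 0 1 * hc
    exact ⟨v, w, hvw, hE, HasEigen.exists_right hvw hE (aux _ e2 h₂'),
      HasEigen.exists_right hvw hE (aux _ e3 h₃')⟩
  · obtain ⟨β, γ, hβγ, g1, g2, g3⟩ := minors_of_orthogonal hpar
      (x := (x₁ * x₂) 0 0 - (x₁ * x₂) 1 1) (y := (x₁ * x₂) 1 0) (z := (x₁ * x₂) 0 1)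
      (x' := (x₁ * x₃) 0 0 - (x₁ * x₃) 1 1) (y' := (x₁ * x₃) 1 0) (z' := (x₁ * x₃) 0 1)
      (by linear_combination e2 - h₂' - (x₁ * x₂) 0 0 * t1')
      (by linear_combination e2 - h₂'' - (x₁ * x₂) 0 0 * t2')
      (by linear_combination e3 - h₃' - (x₁ * x₃) 0 0 * t1')
      (by linear_combination e3 - h₃'' - (x₁ * x₃) 0 0 * t2')
    obtain ⟨α, hα⟩ : ∃ α, α = -(β * (x₁ * x₂) 0 0 + γ * (x₁ * x₃) 0 0) := ⟨_, rfl⟩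
    have k00 : β * x₂ 0 0 + γ * x₃ 0 0 = -α * x₁⁻¹ 0 0 := by
      rw [i2, i3]; simp only [mul_entry x₁⁻¹, hα, inv00, inv01]
      linear_combination -x₁ 0 1 * g2
    have k01 : β * x₂ 0 1 + γ * x₃ 0 1 = -α * x₁⁻¹ 0 1 := by
      rw [i2, i3]; simp only [mul_entry x₁⁻¹, hα, inv00, inv01]
      linear_combination x₁ 0 1 * g1 + x₁ 1 1 * g3
    have k10 : β * x₂ 1 0 + γ * x₃ 1 0 = -α * x₁⁻¹ 1 0 := by
      rw [i2, i3]; simp only [mul_entry x₁⁻¹, hα, inv10, inv11]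
      linear_combination x₁ 0 0 * g2
    have k11 : β * x₂ 1 1 + γ * x₃ 1 1 = -α * x₁⁻¹ 1 1 := by
      rw [i2, i3]; simp only [mul_entry x₁⁻¹, hα, inv10, inv11]
      linear_combination -x₁ 1 0 * g3 - x₁ 0 0 * g1
    have h₁' : tr x₁⁻¹ = t := by rw [tr_inv, h₁]
    have t2 : tr x₁⁻¹ = tr x₂ := h₁'.trans h₂.symm
    have t3 : tr x₁⁻¹ = tr x₃ := h₁'.trans h₃.symm
    by_cases c1 : x₁⁻¹ = x₂
    · exact Or.inl c1
    by_cases c2 : x₁⁻¹ = x₃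
    · exact Or.inr (Or.inl c2)
    by_cases c3 : x₂ = x₃
    · exact Or.inr (Or.inr (Or.inl c3))
    right; right; right
    have hsum : α = -(β + γ) := by
      have : (α + (β + γ)) * t = 0 := by
        simp only [tr] at h₁' h₂ h₃
        linear_combination k00 + k11 - β * h₂ - γ * h₃ - α * h₁'
      exact eq_neg_of_add_eq_zero_left ((mul_eq_zero.1 this).resolve_right ht)
    rw [hsum] at k00 k01 k10 k11
    have par : ∀ {a b a' b' : F}, β * a + γ * a' = 0 → β * b + γ * b' = 0 → a * b' = b * a' := by
      intro a b a' b' q1 q2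
      by_cases hβ : β = 0
      · have hγ : γ ≠ 0 := fun h => hβγ ⟨hβ, h⟩
        rw [hβ, zero_mul, zero_add] at q1 q2
        rw [(mul_eq_zero.1 q1).resolve_left hγ, (mul_eq_zero.1 q2).resolve_left hγ]; ring
      · apply mul_left_cancel₀ hβ
        linear_combination b' * q1 - a' * q2
    have l00 : β * (x₂ 0 0 - x₁⁻¹ 0 0) + γ * (x₃ 0 0 - x₁⁻¹ 0 0) = 0 := by linear_combination k00
    have l01 : β * (x₂ 0 1 - x₁⁻¹ 0 1) + γ * (x₃ 0 1 - x₁⁻¹ 0 1) = 0 := by linear_combination k01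
    have l10 : β * (x₂ 1 0 - x₁⁻¹ 1 0) + γ * (x₃ 1 0 - x₁⁻¹ 1 0) = 0 := by linear_combination k10
    obtain ⟨v, w, r, s, hvw, hr, hn, hb, hc, hn', hb', hc', hE⟩ :=
      exists_rankOne_of_collinear t2 t3 c1 c2 c3 ⟨par l00 l01, par l00 l10, par l01 l10⟩
    have hQ := (exists_hasEigen_iff hvw).1 hE
    refine ⟨v, w, hvw, ?_, ?_, ?_⟩
    · obtain ⟨c, hc⟩ := hE
      exact ⟨c⁻¹, by simpa using hc.inv hvw⟩
    · refine (exists_hasEigen_iff hvw).2 ?_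
      simp only [tr] at t2
      linear_combination hQ + 2 * v * w * hn + w ^ 2 * hb - v ^ 2 * hc + v * w * t2
    · refine (exists_hasEigen_iff hvw).2 ?_
      simp only [tr] at t3
      linear_combination hQ + 2 * v * w * hn' + w ^ 2 * hb' - v ^ 2 * hc' + v * w * t3

end SL2

namespace SL2

open Matrix Matrix.SpecialLinearGroup
open scoped Pointwise

variable {F : Type*} [Field F]

lemma exists_finset_charpoly_roots (t : F) :
    ∃ R : Finset F, #R ≤ 2 ∧ ∀ c, c ^ 2 - t * c + 1 = 0 → c ∈ R := by
  by_cases h : ∃ c, c ^ 2 - t * c + 1 = 0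
  · obtain ⟨c, hc⟩ := h
    refine ⟨{c, t - c}, card_le_two, fun d hd => ?_⟩
    have : (d - c) * (d - (t - c)) = 0 := by linear_combination hd - hc
    rcases mul_eq_zero.1 this with h | h
    · simp [sub_eq_zero.1 h]
    · simp [sub_eq_zero.1 h]
  · push Not at h
    exact ⟨∅, by simp, fun c hc => absurd hc (h c)⟩

lemma HasEigen.parallel {x : SpecialLinearGroup (Fin 2) F} {v w v' w' c : F} (ht : tr x ^ 2 ≠ 4)
    (h : HasEigen x v w c) (h' : HasEigen x v' w' c) : v * w' = w * v' := by
  by_contra hne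
  have hne := sub_ne_zero.2 hne
  obtain ⟨h1, h2⟩ := h
  obtain ⟨h3, h4⟩ := h'
  have e00 : x 0 0 = c := mul_left_cancel₀ hne (by linear_combination w' * h1 - w * h3)
  have e01 : x 0 1 = 0 := mul_left_cancel₀ hne (by linear_combination v * h3 - v' * h1)
  have e11 : x 1 1 = c := mul_left_cancel₀ hne (by linear_combination v * h4 - v' * h2)
  have hd := det_eq x
  rw [e00, e01, e11] at hd
  apply ht
  rw [tr, e00, e11]
  linear_combination 4 * hd

lemma HasEigen.of_parallel {x : SpecialLinearGroup (Fin 2) F} {v w v' w' c : F}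
    (h : HasEigen x v w c) (hv : v ≠ 0 ∨ w ≠ 0) (hp : v * w' = w * v') : HasEigen x v' w' c := by
  obtain ⟨h1, h2⟩ := h
  rcases hv with hv | hv <;> constructor <;> apply mul_left_cancel₀ hv
  · linear_combination v' * h1 + x 0 1 * hp
  · linear_combination v' * h2 + (x 1 1 - c) * hp
  · linear_combination w' * h1 - (x 0 0 - c) * hp
  · linear_combination w' * h2 - x 1 0 * hp

variable [DecidableEq F] {A : Finset (SpecialLinearGroup (Fin 2) F)}

lemma card_common_eigenvector_le (hinv : ∀ a ∈ A, a⁻¹ ∈ A)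
    (hA : Subgroup.closure (A : Set (SpecialLinearGroup (Fin 2) F)) = ⊤) {t : F} (ht : t ^ 2 ≠ 4)
    (k : ℕ) {x : SpecialLinearGroup (Fin 2) F} (hx : tr x = t) :
    #{z ∈ {y ∈ A ^ k | tr y = t} ×ˢ {y ∈ A ^ k | tr y = t} |
      ∃ v w : F, (v ≠ 0 ∨ w ≠ 0) ∧ (∃ c, HasEigen x v w c) ∧
      (∃ c, HasEigen z.1 v w c) ∧ ∃ c, HasEigen z.2 v w c} ≤ 8 * #(A ^ (2 * k + 2)) := by
  obtain ⟨R, hR, hR'⟩ := exists_finset_charpoly_roots t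
  have hvec : ∀ c : F, ∃ u : F × F, (u.1 ≠ 0 ∨ u.2 ≠ 0) ∧
      ∀ v w, (v ≠ 0 ∨ w ≠ 0) → HasEigen x v w c → v * u.2 = w * u.1 := by
    intro c
    by_cases h : ∃ v w, (v ≠ 0 ∨ w ≠ 0) ∧ HasEigen x v w c
    · obtain ⟨v, w, h1, h2⟩ := h
      exact ⟨(v, w), h1, fun v' w' h3 h4 => h4.parallel (hx ▸ ht) h2⟩
    · push Not at h
      exact ⟨(1, 0), by simp, fun v w h1 h2 => absurd h2 (h v w h1)⟩
  choose u hu hu' using hvec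
  calc _ ≤ #((R ×ˢ R ×ˢ R).biUnion fun c =>
        {y ∈ A ^ k | HasEigen y (u c.1).1 (u c.1).2 c.2.1} ×ˢ
        {y ∈ A ^ k | HasEigen y (u c.1).1 (u c.1).2 c.2.2}) := by
        refine card_le_card fun z hz => ?_
        simp only [mem_filter, mem_product] at hz
        obtain ⟨⟨⟨h1, h2⟩, h3, h4⟩, v, w, hvw, ⟨c, hc⟩, ⟨d, hd⟩, e, he⟩ := hz
        simp only [mem_biUnion, mem_product, mem_filter]
        have hp := hu' c v w hvw hc
        exact ⟨(c, d, e), ⟨hR' _ (hx ▸ hc.charpoly hvw), hR' _ (h2 ▸ hd.charpoly hvw),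
          hR' _ (h4 ▸ he.charpoly hvw)⟩, ⟨h1, hd.of_parallel hvw hp⟩, h3, he.of_parallel hvw hp⟩
    _ ≤ #(R ×ˢ R ×ˢ R) * #(A ^ (2 * k + 2)) := by
        refine card_biUnion_le_card_mul _ _ _ fun c _ => ?_
        rw [card_product]
        have h1 := card_hasEigen_sq_le hinv hA (hu c.1) c.2.1 k
        have h2 := card_hasEigen_sq_le hinv hA (hu c.1) c.2.2 k
        nlinarith [sq_nonneg ((#{y ∈ A ^ k | HasEigen y (u c.1).1 (u c.1).2 c.2.1} : ℤ) -
          #{y ∈ A ^ k | HasEigen y (u c.1).1 (u c.1).2 c.2.2})]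
    _ ≤ _ := by
        gcongr
        rw [card_product, card_product]
        calc #R * (#R * #R) ≤ 2 * (2 * 2) := by gcongr
          _ = 8 := rfl

/-- The Larsen–Pink type bound for the elements of a given regular trace. -/
lemma card_trace_slice_le (h1 : 1 ∈ A) (hinv : ∀ a ∈ A, a⁻¹ ∈ A)
    (hA : Subgroup.closure (A : Set (SpecialLinearGroup (Fin 2) F)) = ⊤) {t : F} (ht0 : t ≠ 0)
    (ht : t ^ 2 ≠ 4) (k : ℕ) :
    #{x ∈ A ^ k | tr x = t} ^ 3 ≤ 1728 * #(A ^ (2 * k + 2)) ^ 2 := by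
  set X := {x ∈ A ^ k | tr x = t} with hX
  set N := #(A ^ (2 * k + 2)) with hN
  let f : SpecialLinearGroup (Fin 2) F × SpecialLinearGroup (Fin 2) F ×
    SpecialLinearGroup (Fin 2) F → SpecialLinearGroup (Fin 2) F × SpecialLinearGroup (Fin 2) F :=
    fun z => (z.1 * z.2.1, z.1 * z.2.2)
  let E : SpecialLinearGroup (Fin 2) F → SpecialLinearGroup (Fin 2) F ×
    SpecialLinearGroup (Fin 2) F → Prop := fun x z =>
      ∃ v w : F, (v ≠ 0 ∨ w ≠ 0) ∧ (∃ c, HasEigen x v w c) ∧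
        (∃ c, HasEigen z.1 v w c) ∧ ∃ c, HasEigen z.2 v w c
  let P : SpecialLinearGroup (Fin 2) F × SpecialLinearGroup (Fin 2) F ×
    SpecialLinearGroup (Fin 2) F → Prop := fun z =>
      (z.1⁻¹ = z.2.1 ∨ z.1⁻¹ = z.2.2 ∨ z.2.1 = z.2.2) ∨ E z.1 z.2
  set T := X ×ˢ X ×ˢ X with hT
  have hgood : #{z ∈ T | ¬P z} ≤ 2 * N ^ 2 := by
    calc _ ≤ 2 * #(({z ∈ T | ¬P z}).image f) := by
          refine card_le_mul_card_image _ _ fun b _ => ?_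
          by_contra! hcard
          obtain ⟨x, y, z, hx, hy, hz, hxy, hxz, hyz⟩ := two_lt_card_iff.1 hcard
          simp only [mem_filter, hT, mem_product, hX] at hx hy hz
          obtain ⟨⟨⟨hx1, hx2, hx3⟩, hP⟩, rfl⟩ := hx
          obtain ⟨⟨⟨hy1, hy2, hy3⟩, -⟩, hfy⟩ := hy
          obtain ⟨⟨⟨hz1, hz2, hz3⟩, -⟩, hfz⟩ := hz
          simp only [f, Prod.mk.injEq] at hfy hfz
          have inj : ∀ p q : SpecialLinearGroup (Fin 2) F × SpecialLinearGroup (Fin 2) F ×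
              SpecialLinearGroup (Fin 2) F, p.1 * p.2.1 = q.1 * q.2.1 → p.1 * p.2.2 = q.1 * q.2.2 →
              p ≠ q → p.1 ≠ q.1 := by
            rintro ⟨a, b, c⟩ ⟨a', b', c'⟩ e1 e2 hne h
            dsimp at e1 e2 h
            subst h
            exact hne (by rw [mul_left_cancel e1, mul_left_cancel e2])
          apply hP
          have := degenerate_of_three_fibre ht0 hx1.2 hx2.2 hx3.2 hy1.2 hz1.2
            (by rw [← hfy.1]; simpa using hy2.2) (by rw [← hfy.2]; simpa using hy3.2)
            (by rw [← hfz.1]; simpa using hz2.2) (by rw [← hfz.2]; simpa using hz3.2)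
            (inj _ _ hfy.1.symm hfy.2.symm hxy) (inj _ _ hfz.1.symm hfz.2.symm hxz)
            (inj _ _ (hfy.1.trans hfz.1.symm) (hfy.2.trans hfz.2.symm) hyz)
          simpa only [P, E, or_assoc] using this
      _ ≤ 2 * #((A ^ (2 * k + 2)) ×ˢ (A ^ (2 * k + 2))) := by
          gcongr
          intro b hb
          obtain ⟨z, hz, rfl⟩ := mem_image.1 hb
          simp only [mem_filter, hT, mem_product, hX] at hz
          obtain ⟨⟨⟨hx1, -⟩, ⟨hx2, -⟩, hx3, -⟩, -⟩ := hz
          have : A ^ k * A ^ k ⊆ A ^ (2 * k + 2) := by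
            rw [← pow_add]; exact pow_subset_pow_right h1 (by omega)
          exact mem_product.2 ⟨this (mul_mem_mul hx1 hx2), this (mul_mem_mul hx1 hx3)⟩
      _ = 2 * N ^ 2 := by rw [card_product, ← hN, sq]
  have hbad : #{z ∈ T | P z} ≤ 3 * #X ^ 2 + 8 * N * #X := by
    have e1 : #{z ∈ T | z.1⁻¹ = z.2.1} ≤ #X ^ 2 := by
      rw [sq, ← card_product]
      refine card_le_card_of_injOn (fun z => (z.1, z.2.2)) ?_ ?_
      · intro z hz
        simp only [coe_filter, hT, mem_product, Set.mem_ofPred_eq] at hz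
        exact mem_coe.2 (mem_product.2 ⟨hz.1.1, hz.1.2.2⟩)
      · rintro ⟨a, b, c⟩ hz ⟨a', b', c'⟩ hz' h
        simp only [coe_filter, Set.mem_ofPred_eq, Prod.mk.injEq] at hz hz' h
        rw [← hz.2, ← hz'.2, h.1, h.2]
    have e2 : #{z ∈ T | z.1⁻¹ = z.2.2} ≤ #X ^ 2 := by
      rw [sq, ← card_product]
      refine card_le_card_of_injOn (fun z => (z.1, z.2.1)) ?_ ?_
      · intro z hz
        simp only [coe_filter, hT, mem_product, Set.mem_ofPred_eq] at hz
        exact mem_coe.2 (mem_product.2 ⟨hz.1.1, hz.1.2.1⟩)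
      · rintro ⟨a, b, c⟩ hz ⟨a', b', c'⟩ hz' h
        simp only [coe_filter, Set.mem_ofPred_eq, Prod.mk.injEq] at hz hz' h
        rw [← hz.2, ← hz'.2, h.1, h.2]
    have e3 : #{z ∈ T | z.2.1 = z.2.2} ≤ #X ^ 2 := by
      rw [sq, ← card_product]
      refine card_le_card_of_injOn (fun z => (z.1, z.2.1)) ?_ ?_
      · intro z hz
        simp only [coe_filter, hT, mem_product, Set.mem_ofPred_eq] at hz
        exact mem_coe.2 (mem_product.2 ⟨hz.1.1, hz.1.2.1⟩)
      · rintro ⟨a, b, c⟩ hz ⟨a', b', c'⟩ hz' h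
        simp only [coe_filter, Set.mem_ofPred_eq, Prod.mk.injEq] at hz hz' h
        rw [← hz.2, ← hz'.2, h.1, h.2]
    have e4 : #{z ∈ T | E z.1 z.2} ≤ 8 * N * #X := by
      refine card_le_mul_card_image_of_maps_to (f := Prod.fst) (t := X) ?_ (8 * N) ?_
      · intro z hz
        simp only [mem_filter, hT, mem_product] at hz
        exact hz.1.1
      · intro x hx
        refine le_trans ?_ (card_common_eigenvector_le hinv hA ht k (mem_filter.1 hx).2)
        refine card_le_card_of_injOn Prod.snd ?_ ?_
        · intro z hz
          simp only [coe_filter, Set.mem_ofPred_eq, mem_filter, hT, mem_product] at hz ⊢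
          obtain ⟨⟨⟨-, h2, h3⟩, hE⟩, rfl⟩ := hz
          exact ⟨⟨mem_filter.1 h2, mem_filter.1 h3⟩, hE⟩
        · rintro ⟨a, b⟩ hz ⟨a', b'⟩ hz' h
          simp only [coe_filter, Set.mem_ofPred_eq] at hz hz' h
          rw [hz.2, hz'.2, h]
    have : ({z ∈ T | P z}) ⊆ (({z ∈ T | z.1⁻¹ = z.2.1} ∪ {z ∈ T | z.1⁻¹ = z.2.2}) ∪
        {z ∈ T | z.2.1 = z.2.2}) ∪ {z ∈ T | E z.1 z.2} := by
      intro z hz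
      simp only [mem_union, mem_filter, P] at hz ⊢
      obtain ⟨h, (h' | h' | h') | h'⟩ := hz <;> simp only [h, h', true_and, true_or, or_true]
    have c1 := card_le_card this
    have c2 := card_union_le (({z ∈ T | z.1⁻¹ = z.2.1} ∪ {z ∈ T | z.1⁻¹ = z.2.2}) ∪
        {z ∈ T | z.2.1 = z.2.2}) {z ∈ T | E z.1 z.2}
    have c3 := card_union_le ({z ∈ T | z.1⁻¹ = z.2.1} ∪ {z ∈ T | z.1⁻¹ = z.2.2})
        {z ∈ T | z.2.1 = z.2.2}
    have c4 := card_union_le {z ∈ T | z.1⁻¹ = z.2.1} {z ∈ T | z.1⁻¹ = z.2.2}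
    omega
  have htot : #X ^ 3 ≤ 2 * N ^ 2 + (3 * #X ^ 2 + 8 * N * #X) := by
    have : #{z ∈ T | P z} + #{z ∈ T | ¬P z} = #T := card_filter_add_card_filter_not _
    have hc : #T = #X ^ 3 := by rw [hT, card_product, card_product]; ring
    omega
  have hN1 : 1 ≤ N := card_pos.2 ⟨1, one_mem_pow h1⟩
  generalize #X = a at *
  by_contra! hlt
  have h12 : 12 < a := by
    by_contra! h
    have : a ^ 3 ≤ 12 ^ 3 := Nat.pow_le_pow_left h 3
    nlinarith
  have hNa : 144 * N ^ 2 < a ^ 3 := by nlinarith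
  have h8 : 24 * N < a ^ 2 := by
    by_contra! h
    have : a ^ 2 * a ^ 2 ≤ 24 * N * (24 * N) := Nat.mul_le_mul h h
    nlinarith [sq_nonneg a]
  nlinarith [sq_nonneg a]

end SL2

namespace SL2

open Matrix Matrix.SpecialLinearGroup
open scoped Pointwise

variable {F : Type*} [Field F]

lemma exists_smul_of_commute {x g : SpecialLinearGroup (Fin 2) F} (hg : tr g ^ 2 ≠ 4)
    (h : Commute x g) : ∃ s, x 0 0 - x 1 1 = s * (g 0 0 - g 1 1) ∧ x 0 1 = s * g 0 1 ∧
      x 1 0 = s * g 1 0 := by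
  obtain ⟨h1, h2, h3, -⟩ := ext_iff₂.1 (h : x * g = g * x)
  simp only [mul_entry] at h1 h2 h3
  refine exists_eq_smul_of_minors ?_ ?_ ?_ ?_
  · rintro ⟨e1, e2, e3⟩
    have hd := det_eq g
    rw [e2] at hd
    apply hg
    rw [tr]
    linear_combination (g 0 0 - g 1 1) * e1 + 4 * hd
  · linear_combination -h2
  · linear_combination h3
  · linear_combination -h1

lemma commute_of_smul {x y : SpecialLinearGroup (Fin 2) F} {a b c s r : F}
    (hx : x 0 0 - x 1 1 = s * a ∧ x 0 1 = s * b ∧ x 1 0 = s * c)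
    (hy : y 0 0 - y 1 1 = r * a ∧ y 0 1 = r * b ∧ y 1 0 = r * c) : Commute x y := by
  obtain ⟨h1, h2, h3⟩ := hx
  obtain ⟨h4, h5, h6⟩ := hy
  have h1 := eq_add_of_sub_eq h1
  have h4 := eq_add_of_sub_eq h4
  refine ext_iff₂.2 ?_
  simp only [mul_entry, h1, h2, h3, h4, h5, h6]
  refine ⟨?_, ?_, ?_, ?_⟩ <;> ring

/-- Commuting with a common regular element is transitive. -/
lemma commute_of_commute_regular {x y g : SpecialLinearGroup (Fin 2) F} (hg : tr g ^ 2 ≠ 4)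
    (hx : Commute x g) (hy : Commute y g) : Commute x y := by
  obtain ⟨s, hs⟩ := exists_smul_of_commute hg hx
  obtain ⟨r, hr⟩ := exists_smul_of_commute hg hy
  exact commute_of_smul hs hr

lemma eq_or_eq_inv_of_commute (h2 : (2 : F) ≠ 0) {x y g : SpecialLinearGroup (Fin 2) F}
    (hg : tr g ^ 2 ≠ 4) (hx : Commute x g) (hy : Commute y g) (ht : tr x = tr y) :
    y = x ∨ y = x⁻¹ := by
  obtain ⟨s, s1, s2, s3⟩ := exists_smul_of_commute hg hx
  obtain ⟨r, r1, r2, r3⟩ := exists_smul_of_commute hg hy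
  have dx := det_eq x
  have dy := det_eq y
  have dg := det_eq g
  simp only [tr] at ht hg
  have hsr : (r - s) * (r + s) = 0 := by
    have : ((g 0 0 + g 1 1) ^ 2 - 4) * ((r - s) * (r + s)) = 0 := by
      have e : ∀ (z : SpecialLinearGroup (Fin 2) F) (u : F), z 0 0 - z 1 1 = u * (g 0 0 - g 1 1) →
          z 0 1 = u * g 0 1 → z 1 0 = u * g 1 0 →
          (z 0 0 + z 1 1) ^ 2 - 4 = u ^ 2 * ((g 0 0 + g 1 1) ^ 2 - 4) := by
        intro z u h1 h2 h3
        have dz := det_eq z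
        rw [h2, h3] at dz
        linear_combination 4 * dz - 4 * u ^ 2 * dg +
          (z 0 0 - z 1 1 + u * (g 0 0 - g 1 1)) * h1
      linear_combination (e x s s1 s2 s3) - (e y r r1 r2 r3) -
        (x 0 0 + x 1 1 + (y 0 0 + y 1 1)) * ht
    exact (mul_eq_zero.1 this).resolve_left (sub_ne_zero.2 hg)
  rw [ext_iff₂, ext_iff₂]
  simp only [inv00, inv01, inv10, inv11]
  rcases mul_eq_zero.1 hsr with h | h
  · left
    refine ⟨mul_left_cancel₀ h2 ?_, ?_, ?_, mul_left_cancel₀ h2 ?_⟩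
    · linear_combination r1 - s1 - ht + (g 0 0 - g 1 1) * h
    · linear_combination r2 - s2 + g 0 1 * h
    · linear_combination r3 - s3 + g 1 0 * h
    · linear_combination s1 - r1 - ht - (g 0 0 - g 1 1) * h
  · right
    refine ⟨mul_left_cancel₀ h2 ?_, ?_, ?_, mul_left_cancel₀ h2 ?_⟩
    · linear_combination r1 + s1 - ht + (g 0 0 - g 1 1) * h
    · linear_combination r2 + s2 + g 0 1 * h
    · linear_combination r3 + s3 + g 1 0 * h
    · linear_combination -s1 - r1 - ht - (g 0 0 - g 1 1) * h

lemma card_commute_tr_le [DecidableEq F] (h2 : (2 : F) ≠ 0) {g : SpecialLinearGroup (Fin 2) F}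
    (hg : tr g ^ 2 ≠ 4) (S : Finset (SpecialLinearGroup (Fin 2) F)) (t : F) :
    #{x ∈ S | Commute x g ∧ tr x = t} ≤ 2 := by
  rcases ({x ∈ S | Commute x g ∧ tr x = t}).eq_empty_or_nonempty with h | ⟨x, hx⟩
  · simp [h]
  · refine (card_le_card fun y hy => ?_).trans (card_le_two (a := x) (b := x⁻¹))
    simp only [mem_filter] at hx hy
    simpa using eq_or_eq_inv_of_commute h2 hg hx.2.1 hy.2.1 (hx.2.2.trans hy.2.2.symm)

lemma card_commute_le [Fintype F] [DecidableEq F] (h2 : (2 : F) ≠ 0)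
    {g : SpecialLinearGroup (Fin 2) F}
    (hg : tr g ^ 2 ≠ 4) (S : Finset (SpecialLinearGroup (Fin 2) F)) :
    #{x ∈ S | Commute x g} ≤ 2 * Fintype.card F := by
  refine card_le_mul_card_image_of_maps_to (f := tr) (t := univ) (fun _ _ => mem_univ _) 2
    fun t _ => ?_
  rw [filter_filter]
  exact card_commute_tr_le h2 hg S t

lemma card_conj_commute_le [Fintype F] [DecidableEq F] (h2 : (2 : F) ≠ 0)
    {g y : SpecialLinearGroup (Fin 2) F} (hg : tr g ^ 2 ≠ 4) (hy : tr y ^ 2 ≠ 4) :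
    #{x : SpecialLinearGroup (Fin 2) F | Commute (x * g * x⁻¹) y} ≤ 4 * Fintype.card F := by
  calc _ ≤ 2 * Fintype.card F *
        #{z : SpecialLinearGroup (Fin 2) F | Commute z y ∧ tr z = tr g} := by
        refine card_le_mul_card_image_of_maps_to (f := fun x => x * g * x⁻¹) ?_ _ fun z _ => ?_
        · intro x hx
          simp only [mem_univ, true_and, mem_filter] at hx ⊢
          exact ⟨hx, tr_conj x g⟩
        · rcases ({x ∈ ({x | Commute (x * g * x⁻¹) y} :
            Finset (SpecialLinearGroup (Fin 2) F)) | x * g * x⁻¹ = z}).eq_empty_or_nonempty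
            with h | ⟨x₀, hx₀⟩
          · simp [h]
          refine le_trans ?_ (card_commute_le h2 hg univ)
          refine card_le_card_of_injOn (fun x => x₀⁻¹ * x) ?_ (fun a _ b _ h => mul_left_cancel h)
          intro x hx
          simp only [coe_filter, mem_univ, true_and, Set.mem_ofPred_eq, mem_filter] at hx hx₀ ⊢
          have : x * g * x⁻¹ = x₀ * g * x₀⁻¹ := hx.2.trans hx₀.2.symm
          rw [Commute, SemiconjBy]
          calc x₀⁻¹ * x * g = x₀⁻¹ * (x * g * x⁻¹) * x := by group
            _ = g * (x₀⁻¹ * x) := by rw [this]; group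
    _ ≤ 2 * Fintype.card F * 2 := by
        gcongr
        exact card_commute_tr_le h2 hy univ _
    _ = _ := by ring

variable [DecidableEq F] {A : Finset (SpecialLinearGroup (Fin 2) F)}

lemma card_le_card_commute_mul (hinv : ∀ a ∈ A, a⁻¹ ∈ A) {k : ℕ}
    {h : SpecialLinearGroup (Fin 2) F} (hh : h ∈ A ^ k) :
    #A ≤ #{y ∈ A ^ 2 | Commute y h} * #{x ∈ A ^ (k + 2) | tr x = tr h} := by
  refine card_le_mul_card_image_of_maps_to (f := fun x => x * h * x⁻¹) ?_ _ fun z _ => ?_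
  · intro x hx
    rw [mem_filter, tr_conj]
    refine ⟨?_, rfl⟩
    rw [show k + 2 = 1 + k + 1 by ring, pow_succ, pow_add, pow_one]
    exact mul_mem_mul (mul_mem_mul hx hh) (hinv _ hx)
  · rcases ({x ∈ A | x * h * x⁻¹ = z}).eq_empty_or_nonempty with e | ⟨x₀, hx₀⟩
    · simp [e]
    refine card_le_card_of_injOn (fun x => x₀⁻¹ * x) ?_ (fun a _ b _ h => mul_left_cancel h)
    intro x hx
    simp only [coe_filter, Set.mem_ofPred_eq, mem_filter] at hx hx₀ ⊢
    refine ⟨by rw [sq]; exact mul_mem_mul (hinv _ hx₀.1) hx.1, ?_⟩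
    have : x * h * x⁻¹ = x₀ * h * x₀⁻¹ := hx.2.trans hx₀.2.symm
    rw [Commute, SemiconjBy]
    calc x₀⁻¹ * x * h = x₀⁻¹ * (x * h * x⁻¹) * x := by group
      _ = h * (x₀⁻¹ * x) := by rw [this]; group

section Card

variable [Fintype F]

lemma card_pow_three_le : Fintype.card F ^ 3 ≤ 2 * Fintype.card (SpecialLinearGroup (Fin 2) F) := by
  have hq : 2 ≤ Fintype.card F := Fintype.one_lt_card
  have h : Fintype.card (Fˣ × F × F) ≤ Fintype.card (SpecialLinearGroup (Fin 2) F) := by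
    refine Fintype.card_le_of_injective
      (fun z => ⟨!![(z.1 : F), z.2.1; z.2.2, (1 + z.2.1 * z.2.2) * (z.1⁻¹ : Fˣ)], ?_⟩) ?_
    · simp [mul_comm]
    · rintro ⟨a, b, c⟩ ⟨a', b', c'⟩ e
      have := ext_iff₂.1 e
      simp at this
      simp [Units.ext_iff, this]
  rw [Fintype.card_prod, Fintype.card_prod, Fintype.card_units] at h
  obtain ⟨n, hn⟩ := Nat.exists_eq_add_of_le hq
  rw [hn] at h ⊢
  have : 2 + n - 1 = 1 + n := by omega
  rw [this] at h
  nlinarith [sq_nonneg n]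

lemma card_le_pow_three : Fintype.card (SpecialLinearGroup (Fin 2) F) ≤ Fintype.card F ^ 3 := by
  have h : Fintype.card (SpecialLinearGroup (Fin 2) F) ≤ Fintype.card (F × F × F) := by
    refine Fintype.card_le_of_injective
      (fun x => (x 0 0, x 0 1, if x 0 0 = 0 then x 1 1 else x 1 0)) ?_
    intro x y e
    simp only [Prod.mk.injEq] at e
    obtain ⟨e1, e2, e3⟩ := e
    have dx := det_eq x
    have dy := det_eq y
    rw [← e1, ← e2] at dy
    rw [← e1] at e3
    rw [ext_iff₂]
    by_cases h0 : x 0 0 = 0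
    · rw [if_pos h0, if_pos h0] at e3
      rw [h0] at dx dy
      have h1 : x 0 1 ≠ 0 := by rintro h; simp [h] at dx
      exact ⟨e1, e2, mul_left_cancel₀ h1 (by linear_combination dy - dx), e3⟩
    · rw [if_neg h0, if_neg h0] at e3
      exact ⟨e1, e2, e3, mul_left_cancel₀ h0 (by linear_combination dx - dy + x 0 1 * e3)⟩
  simpa [pow_succ, mul_assoc] using h

end Card

end SL2

namespace SL2

open Matrix Matrix.SpecialLinearGroup
open scoped Pointwise

variable {F : Type*} [Field F] [DecidableEq F] {A : Finset (SpecialLinearGroup (Fin 2) F)}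

lemma card_le_add_card_regular (h2 : (2 : F) ≠ 0) {g : SpecialLinearGroup (Fin 2) F}
    (hg : tr g ^ 2 ≠ 4) (S : Finset (SpecialLinearGroup (Fin 2) F)) :
    #{y ∈ S | Commute y g} ≤ #{y ∈ S | Commute y g ∧ tr y ^ 2 ≠ 4} + 4 := by
  have hsub : {y ∈ S | Commute y g} ⊆ ({y ∈ S | Commute y g ∧ tr y ^ 2 ≠ 4} ∪
      {y ∈ S | Commute y g ∧ tr y = 2}) ∪ {y ∈ S | Commute y g ∧ tr y = -2} := by
    intro y hy
    simp only [mem_union, mem_filter] at hy ⊢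
    by_cases h : tr y ^ 2 = 4
    · have : (tr y - 2) * (tr y + 2) = 0 := by linear_combination h
      rcases mul_eq_zero.1 this with h | h
      · exact Or.inl (Or.inr ⟨hy.1, hy.2, sub_eq_zero.1 h⟩)
      · exact Or.inr ⟨hy.1, hy.2, eq_neg_of_add_eq_zero_left h⟩
    · exact Or.inl (Or.inl ⟨hy.1, hy.2, h⟩)
  have c1 := card_le_card hsub
  have c2 := card_union_le ({y ∈ S | Commute y g ∧ tr y ^ 2 ≠ 4} ∪
      {y ∈ S | Commute y g ∧ tr y = 2}) {y ∈ S | Commute y g ∧ tr y = -2}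
  have c3 := card_union_le {y ∈ S | Commute y g ∧ tr y ^ 2 ≠ 4}
      {y ∈ S | Commute y g ∧ tr y = 2}
  have c4 := card_commute_tr_le h2 hg S 2
  have c5 := card_commute_tr_le h2 hg S (-2)
  omega

lemma card_le_mul_card_commute_cube {M : ℝ} (h1 : 1 ∈ A) (hinv : ∀ a ∈ A, a⁻¹ ∈ A)
    (hA : Subgroup.closure (A : Set (SpecialLinearGroup (Fin 2) F)) = ⊤)
    (hgrow : (#(A ^ 26) : ℝ) ≤ M * #A) {h : SpecialLinearGroup (Fin 2) F} (hh : h ∈ A ^ 10)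
    (ht0 : tr h ≠ 0) (ht : tr h ^ 2 ≠ 4) :
    (#A : ℝ) ≤ 1728 * M ^ 2 * (#{y ∈ A ^ 2 | Commute y h} : ℝ) ^ 3 := by
  have c1 : (#A : ℝ) ≤ #{y ∈ A ^ 2 | Commute y h} * #{x ∈ A ^ 12 | tr x = tr h} := by
    exact_mod_cast card_le_card_commute_mul hinv hh
  have c2 : (#{x ∈ A ^ 12 | tr x = tr h} : ℝ) ^ 3 ≤ 1728 * (#(A ^ 26) : ℝ) ^ 2 := by
    have := card_trace_slice_le h1 hinv hA ht0 ht 12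
    rw [show 2 * 12 + 2 = 26 from rfl] at this
    exact_mod_cast this
  have hpos : (0 : ℝ) < #A := by exact_mod_cast card_pos.2 ⟨1, h1⟩
  have c3 : (#(A ^ 26) : ℝ) ^ 2 ≤ (M * #A) ^ 2 := pow_le_pow_left₀ (Nat.cast_nonneg _) hgrow 2
  have c4 : (#A : ℝ) ^ 3 ≤ (1728 * M ^ 2 * (#{y ∈ A ^ 2 | Commute y h} : ℝ) ^ 3) * #A ^ 2 := by
    calc (#A : ℝ) ^ 3
        ≤ (#{y ∈ A ^ 2 | Commute y h} * #{x ∈ A ^ 12 | tr x = tr h} : ℝ) ^ 3 := by gcongr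
      _ = (#{y ∈ A ^ 2 | Commute y h} : ℝ) ^ 3 * (#{x ∈ A ^ 12 | tr x = tr h} : ℝ) ^ 3 := by ring
      _ ≤ (#{y ∈ A ^ 2 | Commute y h} : ℝ) ^ 3 * (1728 * (M * #A) ^ 2) := by
          gcongr; linarith
      _ = _ := by ring
  have : (#A : ℝ) * #A ^ 2 ≤
      (1728 * M ^ 2 * (#{y ∈ A ^ 2 | Commute y h} : ℝ) ^ 3) * #A ^ 2 := by
    calc (#A : ℝ) * #A ^ 2 = #A ^ 3 := by ring
      _ ≤ _ := c4
  exact le_of_mul_le_mul_right this (by positivity)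

/-- Helfgott's product theorem: a generating set of small doubling is either bounded or
nearly everything. -/
theorem card_le_or_le_card_of_small_growth [Fintype F] (h2 : (2 : F) ≠ 0) (h3 : (3 : F) ≠ 0)
    {M : ℝ} (hM : 1 ≤ M) (h1 : 1 ∈ A) (hinv : ∀ a ∈ A, a⁻¹ ∈ A)
    (hA : Subgroup.closure (A : Set (SpecialLinearGroup (Fin 2) F)) = ⊤)
    (hgrow : (#(A ^ 26) : ℝ) ≤ M * #A) :
    (#A : ℝ) ≤ 1728 * 216 * M ^ 2 ∨
      (Fintype.card F : ℝ) ^ 6 ≤ 1728 * 6859 * M ^ 5 * (#A : ℝ) ^ 2 := by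
  rw [or_iff_not_imp_left, not_le]
  intro hlarge
  obtain ⟨g, hg, hg0, hg4⟩ := exists_regular h2 h3 h1 hinv hA
  let n : SpecialLinearGroup (Fin 2) F → ℕ := fun x => #{y ∈ A ^ 2 | Commute y (x * g * x⁻¹)}
  have hreg : ∀ x, tr (x * g * x⁻¹) ^ 2 ≠ 4 := fun x => by rwa [tr_conj]
  have step : ∀ x, (∃ h ∈ A ^ 10, Commute h (x * g * x⁻¹) ∧ tr h ≠ 0 ∧ tr h ^ 2 ≠ 4) →
      (#A : ℝ) ≤ 1728 * M ^ 2 * (n x : ℝ) ^ 3 ∧ 7 ≤ n x := by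
    rintro x ⟨h, hh, hc, h0, h4⟩
    have e : ({y ∈ A ^ 2 | Commute y h} : Finset (SpecialLinearGroup (Fin 2) F)) =
        {y ∈ A ^ 2 | Commute y (x * g * x⁻¹)} := by
      refine filter_congr fun y _ => ⟨fun hy => ?_, fun hy => ?_⟩
      · exact commute_of_commute_regular h4 hy hc.symm
      · exact commute_of_commute_regular (hreg x) hy hc
    have key := card_le_mul_card_commute_cube h1 hinv hA hgrow hh h0 h4
    rw [e] at key
    refine ⟨key, ?_⟩
    by_contra! hlt
    have : (n x : ℝ) ≤ 6 := by exact_mod_cast Nat.lt_succ_iff.1 hlt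
    have : (n x : ℝ) ^ 3 ≤ 216 := by
      calc (n x : ℝ) ^ 3 ≤ 6 ^ 3 := by gcongr
        _ = 216 := by norm_num
    have : 1728 * M ^ 2 * (n x : ℝ) ^ 3 ≤ 1728 * M ^ 2 * 216 := by gcongr
    have key' : (#A : ℝ) ≤ 1728 * M ^ 2 * (n x : ℝ) ^ 3 := key
    linarith
  have all : ∀ x, ∃ h ∈ A ^ 10, Commute h (x * g * x⁻¹) ∧ tr h ≠ 0 ∧ tr h ^ 2 ≠ 4 := by
    intro x
    have hx : x ∈ Subgroup.closure (A : Set (SpecialLinearGroup (Fin 2) F)) :=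
      hA ▸ Subgroup.mem_top x
    have move : ∀ x, ∀ a ∈ A,
        (∃ h ∈ A ^ 10, Commute h (x * g * x⁻¹) ∧ tr h ≠ 0 ∧ tr h ^ 2 ≠ 4) →
        ∃ h ∈ A ^ 10, Commute h ((a * x) * g * (a * x)⁻¹) ∧ tr h ≠ 0 ∧ tr h ^ 2 ≠ 4 := by
      intro x a ha hx
      have h7 := (step x hx).2
      have h4 := card_le_add_card_regular h2 (hreg x) (A ^ 2)
      have h0 := card_commute_tr_le h2 (hreg x) (A ^ 2) 0
      obtain ⟨y, hy, hy0⟩ : ∃ y ∈ ({y ∈ A ^ 2 | Commute y (x * g * x⁻¹) ∧ tr y ^ 2 ≠ 4} :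
          Finset (SpecialLinearGroup (Fin 2) F)),
          y ∉ ({y ∈ A ^ 2 | Commute y (x * g * x⁻¹) ∧ tr y = 0} :
          Finset (SpecialLinearGroup (Fin 2) F)) := by
        refine exists_mem_notMem_of_card_lt_card ?_
        have h7' : 7 ≤ #{y ∈ A ^ 2 | Commute y (x * g * x⁻¹)} := h7
        omega
      simp only [mem_filter, not_and] at hy hy0
      refine ⟨a * y * a⁻¹, ?_, ?_, ?_, ?_⟩
      · refine pow_subset_pow_right h1 (show 4 ≤ 10 by norm_num) ?_
        rw [show A ^ 4 = A * A ^ 2 * A by rw [← pow_succ', ← pow_succ]]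
        exact mul_mem_mul (mul_mem_mul ha hy.1) (hinv a ha)
      · rw [show a * x * g * (a * x)⁻¹ = a * (x * g * x⁻¹) * a⁻¹ by group]
        exact (SemiconjBy.conj_iff.2 hy.2.1 : SemiconjBy _ _ _)
      · rw [tr_conj]; exact hy0 hy.1 hy.2.1
      · rw [tr_conj]; exact hy.2.2
    induction hx using Subgroup.closure_induction_left with
    | one => exact ⟨g, hg, by simp, hg0, hg4⟩
    | mul_left a ha x _ ih => exact move x a ha ih
    | inv_mul_cancel a ha x _ ih => exact move x a⁻¹ (hinv a ha) ih
  obtain ⟨x₀, -, hx₀⟩ := exists_min_image univ n ⟨1, mem_univ _⟩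
  obtain ⟨hA3, h7⟩ := step x₀ (all x₀)
  set q := Fintype.card F with hq
  have count : Fintype.card (SpecialLinearGroup (Fin 2) F) * (n x₀ - 4) ≤ 4 * q * #(A ^ 2) := by
    calc _ = ∑ x : SpecialLinearGroup (Fin 2) F, (n x₀ - 4) := by simp
      _ ≤ ∑ x : SpecialLinearGroup (Fin 2) F,
          #{y ∈ {y ∈ A ^ 2 | tr y ^ 2 ≠ 4} | Commute (x * g * x⁻¹) y} := by
          refine sum_le_sum fun x _ => ?_
          have e1 := hx₀ x (mem_univ _)
          have e2 : n x ≤ _ + 4 := card_le_add_card_regular h2 (hreg x) (A ^ 2)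
          have e3 : ({y ∈ A ^ 2 | Commute y (x * g * x⁻¹) ∧ tr y ^ 2 ≠ 4} :
              Finset (SpecialLinearGroup (Fin 2) F)) ⊆
              {y ∈ {y ∈ A ^ 2 | tr y ^ 2 ≠ 4} | Commute (x * g * x⁻¹) y} := by
            intro y hy
            simp only [mem_filter] at hy ⊢
            exact ⟨⟨hy.1, hy.2.2⟩, hy.2.1.symm⟩
          have e4 := card_le_card e3
          omega
      _ = ∑ y ∈ A ^ 2 with tr y ^ 2 ≠ 4,
          #{x : SpecialLinearGroup (Fin 2) F | Commute (x * g * x⁻¹) y} :=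
          sum_card_bipartiteAbove_eq_sum_card_bipartiteBelow
            (fun (x y : SpecialLinearGroup (Fin 2) F) => Commute (x * g * x⁻¹) y)
      _ ≤ ∑ y ∈ A ^ 2 with tr y ^ 2 ≠ 4, 4 * q :=
          sum_le_sum fun y hy => card_conj_commute_le h2 hg4 (mem_filter.1 hy).2
      _ ≤ 4 * q * #(A ^ 2) := by
          rw [sum_const, smul_eq_mul, mul_comm]
          gcongr
          exact filter_subset _ _
  have hG : q ^ 3 ≤ 2 * Fintype.card (SpecialLinearGroup (Fin 2) F) := card_pow_three_le
  have hq0 : (0 : ℝ) < q := by exact_mod_cast Fintype.card_pos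
  have hA2 : (#(A ^ 2) : ℝ) ≤ M * #A := by
    refine le_trans ?_ hgrow
    exact_mod_cast card_le_card (pow_subset_pow_right h1 (by norm_num))
  have hn : (n x₀ : ℝ) * q ^ 2 ≤ 19 * M * #A := by
    obtain ⟨m, hm⟩ := Nat.exists_eq_add_of_le h7
    have e1 : n x₀ - 4 = m + 3 := by omega
    rw [e1] at count
    have c1 : (Fintype.card (SpecialLinearGroup (Fin 2) F) : ℝ) * (m + 3) ≤ 4 * q * #(A ^ 2) := by
      exact_mod_cast count
    have c2 : (q : ℝ) ^ 3 ≤ 2 * Fintype.card (SpecialLinearGroup (Fin 2) F) := by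
      exact_mod_cast hG
    have c3 : (q : ℝ) ^ 3 * (m + 3) ≤ 8 * q * (M * #A) := by
      calc (q : ℝ) ^ 3 * (m + 3)
          ≤ 2 * Fintype.card (SpecialLinearGroup (Fin 2) F) * (m + 3) := by gcongr
        _ = 2 * (Fintype.card (SpecialLinearGroup (Fin 2) F) * (m + 3)) := by ring
        _ ≤ 2 * (4 * q * #(A ^ 2)) := by gcongr
        _ ≤ 2 * (4 * q * (M * #A)) := by gcongr
        _ = _ := by ring
    have c4 : (q : ℝ) ^ 2 * (m + 3) ≤ 8 * (M * #A) := by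
      refine le_of_mul_le_mul_left ?_ hq0
      calc (q : ℝ) * (q ^ 2 * (m + 3)) = q ^ 3 * (m + 3) := by ring
        _ ≤ _ := c3
        _ = _ := by ring
    rw [hm]
    push_cast
    have : (0 : ℝ) ≤ (q : ℝ) ^ 2 * m := by positivity
    nlinarith
  have hpos : (0 : ℝ) < #A := by exact_mod_cast card_pos.2 ⟨1, h1⟩
  have : (#A : ℝ) * q ^ 6 ≤ #A * (1728 * 6859 * M ^ 5 * (#A : ℝ) ^ 2) := by
    calc (#A : ℝ) * q ^ 6 ≤ 1728 * M ^ 2 * (n x₀ : ℝ) ^ 3 * q ^ 6 := by gcongr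
      _ = 1728 * M ^ 2 * ((n x₀ : ℝ) * q ^ 2) ^ 3 := by ring
      _ ≤ 1728 * M ^ 2 * (19 * M * #A) ^ 3 := by gcongr
      _ = _ := by ring
  exact le_of_mul_le_mul_left this hpos

end SL2

section ConvolutionOperators

open scoped ComplexConjugate

variable {G : Type*} [Group G] [Fintype G]

/-- The autocorrelation `Σ_y conj (f y) f (y x)`, the convolution kernel of `T* T` for
`T = conv f`. -/
noncomputable def autocorr (f : G → ℂ) : G → ℂ := fun x => ∑ y, conj (f y) * f (y * x)

lemma autocorr_inv (f : G → ℂ) (x : G) : autocorr f x⁻¹ = conj (autocorr f x) := by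
  simp only [autocorr, map_sum, map_mul, Complex.conj_conj]
  refine (Fintype.sum_equiv (Equiv.mulRight x) _ _ fun y => ?_).symm
  simp [mul_comm]

lemma autocorr_eq_conv_self {f : G → ℂ} (hf : ∀ x, f x⁻¹ = conj (f x)) :
    autocorr f = conv f f := by
  funext x
  refine Fintype.sum_equiv (Equiv.inv G) _ _ fun y => ?_
  simp [hf]

lemma conv_conv (f g φ : G → ℂ) : conv f (conv g φ) = conv (conv f g) φ := by
  funext x
  simp only [conv, mul_sum, sum_mul]
  rw [sum_comm' (t' := univ) (s' := fun _ => univ) (by simp)]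
  rw [sum_comm]
  conv_rhs => rw [sum_comm]
  refine sum_congr rfl fun y _ => ?_
  refine Fintype.sum_equiv (Equiv.mulLeft y) _ _ fun z => ?_
  simp [mul_assoc]

lemma sum_conv (f φ : G → ℂ) : ∑ x, conv f φ x = (∑ x, f x) * ∑ x, φ x := by
  simp only [conv]
  rw [sum_comm, sum_mul]
  refine sum_congr rfl fun g _ => ?_
  rw [← mul_sum]
  congr 1
  exact Fintype.sum_equiv (Equiv.mulLeft g⁻¹) _ _ fun x => rfl

lemma sum_conj_conv_mul_conv (f ψ φ : G → ℂ) :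
    ∑ x, conj (conv f ψ x) * conv f φ x = ∑ x, conj (ψ x) * conv (autocorr f) φ x := by
  have h1 : ∀ x, conj (conv f ψ x) * conv f φ x =
      ∑ y, conj (f y) * conj (ψ (y⁻¹ * x)) * ∑ h, f h * φ (h⁻¹ * x) := fun x => by
    simp [conv, sum_mul]
  have h2 : ∀ x, conj (ψ x) * conv (autocorr f) φ x =
      ∑ y, conj (f y) * conj (ψ x) * ∑ g, f (y * g) * φ (g⁻¹ * x) := fun x => by
    simp only [conv, autocorr, sum_mul, mul_sum]
    rw [sum_comm]
    exact sum_congr rfl fun _ _ => sum_congr rfl fun _ _ => by ring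
  simp only [h1, h2]
  rw [sum_comm]
  conv_rhs => rw [sum_comm]
  refine sum_congr rfl fun y _ => ?_
  refine Fintype.sum_equiv (Equiv.mulLeft y⁻¹) _ _ fun x => ?_
  simp only [Equiv.coe_mulLeft]
  congr 1
  refine Fintype.sum_equiv (Equiv.mulLeft y⁻¹) _ _ fun h => ?_
  simp [mul_assoc]

/-- The linear map `φ ↦ f ∗ φ`. -/
noncomputable def convLin (f : G → ℂ) : (G → ℂ) →ₗ[ℂ] (G → ℂ) where
  toFun := conv f
  map_add' φ ψ := by funext x; simp [conv, mul_add, sum_add_distrib]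
  map_smul' c φ := by
    funext x
    simp only [conv, Pi.smul_apply, smul_eq_mul, mul_sum, RingHom.id_apply]
    exact sum_congr rfl fun _ _ => by ring

lemma conv_mul_right (f φ : G → ℂ) (g : G) :
    conv f (fun x => φ (x * g)) = fun x => conv f φ (x * g) := by
  funext x; simp [conv, mul_assoc]

/-- The iterated autocorrelations of `f`. -/
noncomputable def iterAutocorr (f : G → ℂ) : ℕ → G → ℂ
  | 0 => autocorr f
  | j + 1 => autocorr (iterAutocorr f j)

lemma iterAutocorr_inv (f : G → ℂ) (j : ℕ) (x : G) :
    iterAutocorr f j x⁻¹ = conj (iterAutocorr f j x) := by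
  cases j <;> exact autocorr_inv _ _

lemma conv_iterAutocorr_of_eigen {f φ : G → ℂ} {c : ℂ} (h : conv (autocorr f) φ = c • φ) (j : ℕ) :
    conv (iterAutocorr f j) φ = c ^ 2 ^ j • φ := by
  induction j with
  | zero => simpa [iterAutocorr] using h
  | succ j ih =>
    rw [iterAutocorr, autocorr_eq_conv_self (iterAutocorr_inv f j), ← conv_conv, ih]
    have := (convLin (iterAutocorr f j)).map_smul (c ^ 2 ^ j) φ
    change conv _ (c ^ 2 ^ j • φ) = c ^ 2 ^ j • conv _ φ at this
    rw [this, ih, smul_smul, pow_succ 2 j, pow_mul, sq]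

/-- Hilbert–Schmidt bound: if `conv f` acts on `V` as the scalar `c` then `dim V · |c|²` is at
most the squared Hilbert–Schmidt norm of `conv f`. -/
lemma finrank_mul_norm_sq_le (V : Submodule ℂ (G → ℂ)) (f : G → ℂ) (c : ℂ)
    (h : ∀ φ ∈ V, conv f φ = c • φ) :
    (Module.finrank ℂ V : ℝ) * ‖c‖ ^ 2 ≤ Fintype.card G * ∑ x, ‖f x‖ ^ 2 := by
  let e := (WithLp.linearEquiv 2 ℂ (G → ℂ)).symm
  let W : Submodule ℂ (EuclideanSpace ℂ G) := V.map e.toLinearMap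
  have hW : Module.finrank ℂ W = Module.finrank ℂ V := LinearEquiv.finrank_map_eq e V
  let b := stdOrthonormalBasis ℂ W
  have hb : Orthonormal ℂ (fun i => (b i : EuclideanSpace ℂ G)) :=
    b.orthonormal.comp_linearIsometry W.subtypeₗᵢ
  have hmem : ∀ i,
      conv f (b i : EuclideanSpace ℂ G).ofLp = c • (b i : EuclideanSpace ℂ G).ofLp := by
    intro i
    obtain ⟨v, hv, hv'⟩ := (b i).2
    rw [← hv']
    exact h v hv
  have key : ∀ x : G, ∑ i, ‖c * (b i : EuclideanSpace ℂ G).ofLp x‖ ^ 2 ≤ ∑ x, ‖f x‖ ^ 2 := by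
    intro x
    have := hb.sum_inner_products_le (s := univ)
      (WithLp.toLp 2 (fun g => conj (f (x * g⁻¹))) : EuclideanSpace ℂ G)
    refine le_trans (le_of_eq (sum_congr rfl fun i _ => ?_)) (this.trans (le_of_eq ?_))
    · rw [← norm_inner_symm, ← smul_eq_mul, ← Pi.smul_apply, ← hmem]
      congr 2
      simp only [PiLp.inner_apply, conv, RCLike.inner_apply, Complex.conj_conj]
      refine Fintype.sum_equiv ((Equiv.inv G).trans (Equiv.mulRight x)) _ _ fun g => ?_
      simp [mul_comm]
    · rw [EuclideanSpace.norm_sq_eq]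
      refine Fintype.sum_equiv ((Equiv.inv G).trans (Equiv.mulLeft x)) _ _ fun g => ?_
      simp
  have hs := sum_le_sum fun x (_ : x ∈ (univ : Finset G)) => key x
  rw [sum_comm] at hs
  simp only [norm_mul, mul_pow, ← mul_sum] at hs
  have hn : ∀ i, ∑ x, ‖(b i : EuclideanSpace ℂ G).ofLp x‖ ^ 2 = 1 := fun i => by
    rw [← EuclideanSpace.norm_sq_eq, hb.1 i, one_pow]
  simp only [hn, sum_const, card_univ, nsmul_eq_mul, Fintype.card_fin, hW, mul_one] at hs
  linarith

end ConvolutionOperators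

section SpectralBound

open scoped ComplexConjugate

variable {G : Type*} [Group G] [Fintype G]

/-- The top of the numerical range of a symmetric operator is an eigenvalue. -/
lemma exists_hasEigenvalue_rayleigh_le {E : Type*} [NormedAddCommGroup E] [InnerProductSpace ℂ E]
    [FiniteDimensional ℂ E] [Nontrivial E] {T : E →ₗ[ℂ] E} (hT : T.IsSymmetric) :
    ∃ lam : ℝ, Module.End.HasEigenvalue T (lam : ℂ) ∧
      ∀ v, RCLike.re (inner ℂ (T v) v) ≤ lam * ‖v‖ ^ 2 := by
  refine ⟨_, hT.hasEigenvalue_iSup_of_finiteDimensional, fun v => ?_⟩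
  by_cases hv : v = 0
  · simp [hv]
  have hbdd : BddAbove (Set.range fun v : {v : E // v ≠ 0} =>
      RCLike.re (inner ℂ (T ↑v) (v : E)) / ‖(v : E)‖ ^ 2) := by
    refine ⟨‖LinearMap.toContinuousLinearMap T‖, ?_⟩
    rintro _ ⟨v, rfl⟩
    have hv : 0 < ‖(v : E)‖ := norm_pos_iff.2 v.2
    refine (div_le_iff₀ (by positivity)).2 ?_
    refine (RCLike.re_le_norm _).trans ((norm_inner_le_norm _ _).trans ?_)
    have := (LinearMap.toContinuousLinearMap T).le_opNorm v
    rw [LinearMap.coe_toContinuousLinearMap'] at this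
    nlinarith
  have h := le_ciSup hbdd ⟨v, hv⟩
  have hv' : 0 < ‖v‖ := norm_pos_iff.2 hv
  rwa [div_le_iff₀ (by positivity)] at h

/-- Sarnak–Xue multiplicity argument: the norm of `conv f` on mean-zero functions is controlled by
the Hilbert–Schmidt norms of the iterated autocorrelations of `f`, divided by the least dimension
`D` of a nonzero right-invariant space of mean-zero functions. -/
lemma exists_spectral_bound (f : G → ℂ) (D : ℝ)
    (hD : ∀ V : Submodule ℂ (G → ℂ), V ≠ ⊥ → (∀ φ ∈ V, ∑ x, φ x = 0) →
      (∀ φ ∈ V, ∀ g, (fun x => φ (x * g)) ∈ V) → D ≤ Module.finrank ℂ V) :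
    ∃ lam : ℝ, (∀ φ : G → ℂ, ∑ x, φ x = 0 → ∑ x, ‖conv f φ x‖ ^ 2 ≤ lam * ∑ x, ‖φ x‖ ^ 2) ∧
      0 ≤ lam ∧ ∀ j, D * (lam ^ 2 ^ j) ^ 2 ≤ Fintype.card G * ∑ x, ‖iterAutocorr f j x‖ ^ 2 := by
  let T : EuclideanSpace ℂ G →ₗ[ℂ] EuclideanSpace ℂ G :=
    (WithLp.linearEquiv 2 ℂ (G → ℂ)).symm.toLinearMap ∘ₗ convLin (autocorr f) ∘ₗ
      (WithLp.linearEquiv 2 ℂ (G → ℂ)).toLinearMap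
  have hT : ∀ v x, (T v).ofLp x = conv (autocorr f) v.ofLp x := fun _ _ => rfl
  let E : Submodule ℂ (EuclideanSpace ℂ G) :=
    { carrier := {v | ∑ x, v.ofLp x = 0}
      add_mem' := fun {a b} ha hb => by
        simp only [Set.mem_ofPred_eq] at *
        simp [sum_add_distrib, ha, hb]
      zero_mem' := by simp
      smul_mem' := fun c v hv => by
        simp only [Set.mem_ofPred_eq] at *
        simp [← mul_sum, hv] }
  have hE : ∀ v, v ∈ E ↔ ∑ x, v.ofLp x = 0 := fun v => Iff.rfl
  have hTE : ∀ v ∈ E, T v ∈ E := by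
    intro v hv
    rw [hE] at *
    simp only [hT, sum_conv, hv, mul_zero]
  have hinner : ∀ v w : EuclideanSpace ℂ G,
      inner ℂ v (T w) = ∑ x, conj (conv f v.ofLp x) * conv f w.ofLp x := by
    intro v w
    rw [sum_conj_conv_mul_conv]
    simp [PiLp.inner_apply, hT, mul_comm]
  have hsymm : T.IsSymmetric := by
    intro v w
    rw [← inner_conj_symm, hinner, hinner, map_sum]
    refine sum_congr rfl fun x _ => ?_
    simp [mul_comm]
  have hinner' : ∀ v : EuclideanSpace ℂ G,
      RCLike.re (inner ℂ (T v) v) = ∑ x, ‖conv f v.ofLp x‖ ^ 2 := by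
    intro v
    rw [hsymm, hinner, map_sum]
    refine sum_congr rfl fun x _ => ?_
    rw [Complex.conj_mul']
    norm_cast
  have hnorm : ∀ φ : G → ℂ, ‖(WithLp.toLp 2 φ : EuclideanSpace ℂ G)‖ ^ 2 = ∑ x, ‖φ x‖ ^ 2 :=
    fun φ => EuclideanSpace.norm_sq_eq _
  have hsymm' := hsymm.restrict_invariant hTE
  by_cases hne : Nontrivial E
  · obtain ⟨lam, heig, hray⟩ := exists_hasEigenvalue_rayleigh_le hsymm'
    have hlam : ∀ v : E, ∑ x, ‖conv f (v : EuclideanSpace ℂ G).ofLp x‖ ^ 2 ≤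
        lam * ‖v‖ ^ 2 := by
      intro v
      refine le_trans (le_of_eq ?_) (hray v)
      exact (hinner' _).symm
    have h0 : 0 ≤ lam := by
      obtain ⟨v, hv⟩ := exists_ne (0 : E)
      have hv' : 0 < ‖(v : E)‖ ^ 2 := by have := norm_pos_iff.2 hv; positivity
      have := (sum_nonneg fun x _ => by positivity).trans (hlam v)
      exact nonneg_of_mul_nonneg_left this hv'
    refine ⟨lam, fun φ hφ => ?_, h0, fun j => ?_⟩
    · have := hlam ⟨WithLp.toLp 2 φ, hφ⟩
      rw [← hnorm φ]; exact this
    · let V : Submodule ℂ (G → ℂ) :=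
        LinearMap.ker (convLin (autocorr f) - (lam : ℂ) • LinearMap.id) ⊓
          LinearMap.ker (∑ x, LinearMap.proj x : (G → ℂ) →ₗ[ℂ] ℂ)
      have hV : ∀ φ, φ ∈ V ↔ conv (autocorr f) φ = (lam : ℂ) • φ ∧ ∑ x, φ x = 0 := by
        intro φ
        simp only [V, Submodule.mem_inf, LinearMap.mem_ker, LinearMap.sub_apply,
          LinearMap.smul_apply, LinearMap.id_apply, sub_eq_zero, LinearMap.sum_apply,
          LinearMap.proj_apply]
        rfl
      have hDV := hD V ?_ (fun φ hφ => ((hV φ).1 hφ).2) ?_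
      · have := finrank_mul_norm_sq_le V (iterAutocorr f j) ((lam : ℂ) ^ 2 ^ j)
          (fun φ hφ => conv_iterAutocorr_of_eigen ((hV φ).1 hφ).1 j)
        refine le_trans ?_ this
        rw [norm_pow, Complex.norm_real, Real.norm_of_nonneg h0]
        gcongr
      · obtain ⟨v, hv⟩ := heig.exists_hasEigenvector
        refine (Submodule.ne_bot_iff _).2 ⟨(v : EuclideanSpace ℂ G).ofLp, (hV _).2 ⟨?_, v.2⟩, ?_⟩
        · have := congrArg (fun v : E => (v : EuclideanSpace ℂ G).ofLp) hv.apply_eq_smul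
          exact this
        · intro h
          refine hv.2 ?_
          ext x
          exact congrFun h x
      · intro φ hφ g
        rw [hV] at hφ ⊢
        refine ⟨?_, ?_⟩
        · rw [conv_mul_right, hφ.1]; rfl
        · rw [← hφ.2]; exact Fintype.sum_equiv (Equiv.mulRight g) _ _ fun x => rfl
  · refine ⟨0, fun φ hφ => ?_, le_rfl, fun j => ?_⟩
    · rw [not_nontrivial_iff_subsingleton] at hne
      have h := Subsingleton.elim (⟨WithLp.toLp 2 φ, hφ⟩ : E) 0
      have h' := congrArg (fun v : E => (v : EuclideanSpace ℂ G).ofLp) h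
      have h'' : φ = 0 := by simpa using h'
      subst h''; simp [conv]
    · simp only [ne_eq, pow_eq_zero_iff', two_ne_zero, false_and, not_false_eq_true, zero_pow,
        mul_zero]
      positivity

end SpectralBound

section Quasirandom

variable {G : Type*} [Group G] [Fintype G] {p : ℕ} [Fact p.Prime]

lemma le_two_mul_card_image_sq (p : ℕ) [Fact p.Prime] :
    p ≤ 2 * #((univ.erase (0 : ZMod p)).image fun a => a ^ 2) + 1 := by
  have h := card_le_mul_card_image (f := fun a : ZMod p => a ^ 2) (univ.erase 0) 2 (fun b hb => by
    obtain ⟨a, -, rfl⟩ := mem_image.1 hb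
    refine (card_le_card (t := {a, -a}) fun x hx => ?_).trans card_le_two
    simpa using sq_eq_sq_iff_eq_or_eq_neg.1 (mem_filter.1 hx).2)
  rw [card_erase_of_mem (mem_univ _), card_univ, ZMod.card] at h
  omega

/-- A right-invariant space of functions on `G` containing a function which is not invariant under
a one-parameter subgroup `U`, normalised by elements acting on it by all squares, has dimension at
least `(p - 1) / 2`. -/
lemma le_two_mul_finrank_add_one_of_not_invariant (U : ZMod p → G)
    (hU : ∀ s t, U (s + t) = U s * U t)
    (hd : ∀ a : ZMod p, a ≠ 0 → ∃ d, ∀ s, U s * d = d * U (a ^ 2 * s))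
    (V : Submodule ℂ (G → ℂ)) (hV : ∀ φ ∈ V, ∀ g, (fun x => φ (x * g)) ∈ V) {f : G → ℂ}
    (hf : f ∈ V) {s₀ : ZMod p} {x₀ : G} (hne : f (x₀ * U s₀) ≠ f x₀) :
    p ≤ 2 * Module.finrank ℂ V + 1 := by
  have hp : (p : ℂ) ≠ 0 := by exact_mod_cast (Fact.out : p.Prime).ne_zero
  let ψ : AddChar (ZMod p) ℂ := ZMod.stdAddChar
  let F : ZMod p → G → ℂ := fun c => ∑ t, ψ (-(c * t)) • fun x => f (x * U t)
  have hFx : ∀ c x, F c x = ∑ t, ψ (-(c * t)) * f (x * U t) := fun c x => by simp [F]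
  have hFV : ∀ c, F c ∈ V := fun c =>
    V.sum_mem fun t _ => V.smul_mem _ (hV f hf _)
  have htrans : ∀ c s x, F c (x * U s) = ψ (c * s) * F c x := by
    intro c s x
    rw [hFx, hFx, mul_sum]
    refine Fintype.sum_equiv (Equiv.addLeft s) _ _ fun t => ?_
    simp only [Equiv.coe_addLeft, hU, ← mul_assoc, ← AddChar.map_add_eq_mul]
    congr 2
    ring
  have hsum : ∀ x, ∑ c, F c x = p * f x := by
    intro x
    simp only [hFx]
    rw [sum_comm]
    simp only [← sum_mul, ← mul_neg]
    simp only [AddChar.sum_mulShift _ (ZMod.isPrimitive_stdAddChar p), ψ]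
    rw [sum_eq_single 0]
    · have h0 : U 0 = 1 := by simpa using hU 0 0
      simp [h0]
    · intro b _ hb; simp [hb]
    · simp
  obtain ⟨c, hc, hFc⟩ : ∃ c, c ≠ 0 ∧ F c ≠ 0 := by
    by_contra! h
    have h1 : ∀ x, F 0 x = p * f x := fun x => by
      rw [← hsum, sum_eq_single 0 (fun c _ hc => by rw [h c hc]; rfl) (by simp)]
    have h2 := htrans 0 s₀ x₀
    simp only [zero_mul, AddChar.map_zero_eq_one, one_mul, h1] at h2
    exact hne (mul_left_cancel₀ hp h2)
  set T := (univ.erase (0 : ZMod p)).image fun a => a ^ 2 with hT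
  have hv : ∀ t : T, ∃ v : V, v ≠ 0 ∧ ∀ x, v.1 (x * U 1) = ψ (c * t) * v.1 x := by
    rintro ⟨t, ht⟩
    obtain ⟨a, ha, rfl⟩ := mem_image.1 ht
    obtain ⟨d, hd⟩ := hd a (ne_of_mem_erase ha)
    refine ⟨⟨fun x => F c (x * d), hV _ (hFV c) d⟩, fun h => hFc ?_, fun x => ?_⟩
    · funext x
      have := congrFun (congrArg Subtype.val h) (x * d⁻¹)
      simpa using this
    · simp only [mul_assoc, hd, mul_one]
      rw [← mul_assoc, htrans]
  choose v hv0 hv using hv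
  let R : (G → ℂ) →ₗ[ℂ] (G → ℂ) := LinearMap.funLeft ℂ ℂ fun x => x * U 1
  have hli : LinearIndependent ℂ fun t => (v t : G → ℂ) := by
    refine Module.End.eigenvectors_linearIndependent' R (fun t : T => ψ (c * t)) ?_ _ fun t => ?_
    · intro s t hst
      have := ZMod.injective_stdAddChar hst
      exact Subtype.ext (mul_left_cancel₀ hc this)
    · rw [Module.End.hasEigenvector_iff, Module.End.mem_eigenspace_iff]
      exact ⟨funext fun x => hv t x, fun h => hv0 t (Subtype.ext h)⟩
  have hcard := (LinearIndependent.of_comp V.subtype hli).fintype_card_le_finrank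
  rw [Fintype.card_coe] at hcard
  have hT' : p ≤ 2 * #T + 1 := by convert le_two_mul_card_image_sq p
  omega

end Quasirandom

namespace SL2

open Matrix Matrix.SpecialLinearGroup

section Unipotent

variable {F : Type*} [Field F]

/-- Upper unipotent elements. -/
def upper (s : F) : SpecialLinearGroup (Fin 2) F := ⟨!![1, s; 0, 1], by simp [det_fin_two]⟩

/-- Lower unipotent elements. -/
def lower (s : F) : SpecialLinearGroup (Fin 2) F := ⟨!![1, 0; s, 1], by simp [det_fin_two]⟩

/-- Diagonal elements. -/
def diag (a : F) (ha : a ≠ 0) : SpecialLinearGroup (Fin 2) F :=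
  ⟨!![a, 0; 0, a⁻¹], by simp [det_fin_two, ha]⟩

lemma upper_add (s t : F) : upper (s + t) = upper s * upper t := by
  rw [ext_iff₂]; simp only [mul_entry]; simp [upper, add_comm]

lemma lower_add (s t : F) : lower (s + t) = lower s * lower t := by
  rw [ext_iff₂]; simp only [mul_entry]; simp [lower]

lemma upper_mul_diag {a : F} (ha : a ≠ 0) (s : F) :
    upper s * diag a⁻¹ (inv_ne_zero ha) = diag a⁻¹ (inv_ne_zero ha) * upper (a ^ 2 * s) := by
  rw [ext_iff₂]; simp only [mul_entry]; simp [upper, diag]; field_simp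

lemma lower_mul_diag {a : F} (ha : a ≠ 0) (s : F) :
    lower s * diag a ha = diag a ha * lower (a ^ 2 * s) := by
  rw [ext_iff₂]; simp only [mul_entry]; simp [lower, diag]; field_simp

/-- `SL₂` is generated by its upper and lower unipotent elements. -/
lemma unipotent_induction {P : SpecialLinearGroup (Fin 2) F → Prop} (h1 : P 1)
    (hu : ∀ x s, P x → P (x * upper s)) (hl : ∀ x s, P x → P (x * lower s))
    (x : SpecialLinearGroup (Fin 2) F) : P x := by
  have key : ∀ x : SpecialLinearGroup (Fin 2) F, x 1 0 ≠ 0 → P x := by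
    intro x hx
    have hd := det_eq x
    have e : x = 1 * upper ((x 0 0 - 1) / x 1 0) * lower (x 1 0) *
        upper ((x 1 1 - 1) / x 1 0) := by
      rw [ext_iff₂]; simp only [mul_entry]; simp [upper, lower]
      field_simp
      refine ⟨by ring, ?_, by ring⟩
      linear_combination -hd
    rw [e]
    exact hu _ _ (hl _ _ (hu _ _ h1))
  by_cases hx : x 1 0 = 0
  · have e : x = x * lower 1 * lower (-1) := by
      rw [mul_assoc, ← lower_add, ext_iff₂]; simp only [mul_entry]; simp [lower]
    rw [e]
    refine hl _ _ (key _ ?_)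
    have hd := det_eq x
    simp only [mul_entry]
    simp only [lower, hx]
    intro h
    simp at h
    rw [hx, h] at hd
    simp at hd
  · exact key x hx

end Unipotent

/-- Frobenius: nonzero right-invariant spaces of mean-zero functions on `SL₂(𝔽_p)` have dimension
at least `(p - 1) / 2`. -/
lemma le_two_mul_finrank_add_one {p : ℕ} [Fact p.Prime]
    (V : Submodule ℂ (SpecialLinearGroup (Fin 2) (ZMod p) → ℂ)) (hV0 : V ≠ ⊥)
    (hsum : ∀ φ ∈ V, ∑ x, φ x = 0) (hV : ∀ φ ∈ V, ∀ g, (fun x => φ (x * g)) ∈ V) :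
    p ≤ 2 * Module.finrank ℂ V + 1 := by
  obtain ⟨f, hf, hf0⟩ := (Submodule.ne_bot_iff _).1 hV0
  by_contra hlt
  have hu : ∀ x s, f (x * upper s) = f x := by
    by_contra! h
    obtain ⟨x, s, h⟩ := h
    exact hlt (le_two_mul_finrank_add_one_of_not_invariant upper upper_add
      (fun a ha => ⟨_, upper_mul_diag ha⟩) V hV hf h)
  have hl : ∀ x s, f (x * lower s) = f x := by
    by_contra! h
    obtain ⟨x, s, h⟩ := h
    exact hlt (le_two_mul_finrank_add_one_of_not_invariant lower lower_add
      (fun a ha => ⟨_, lower_mul_diag ha⟩) V hV hf h)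
  have hconst : ∀ x, f x = f 1 := unipotent_induction rfl
    (fun x s h => by rw [hu, h]) (fun x s h => by rw [hl, h])
  have hs := hsum f hf
  simp only [fun x => hconst x, sum_const, card_univ, nsmul_eq_mul, mul_eq_zero,
    Nat.cast_eq_zero, Fintype.card_ne_zero, false_or] at hs
  exact hf0 (funext fun x => by rw [hconst, hs]; rfl)

end SL2

section RealAutocorrelation

variable {G : Type*} [Group G] [Fintype G]

/-- The iterated autocorrelations of a real function. -/
noncomputable def iterCorr (ν : G → ℝ) : ℕ → G → ℝ
  | 0 => fun x => ∑ y, ν y * ν (y * x)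
  | j + 1 => fun x => ∑ y, iterCorr ν j y * iterCorr ν j (y * x)

lemma sum_coset_corr_le {ν : G → ℝ} (h0 : ∀ x, 0 ≤ ν x) (h1 : ∑ x, ν x = 1) {H : Subgroup G}
    {η : ℝ} (hη : ∀ a, ∑ x with a⁻¹ * x ∈ H, ν x ≤ η) (a : G) :
    ∑ x with a⁻¹ * x ∈ H, ∑ y, ν y * ν (y * x) ≤ η := by
  rw [sum_comm]
  calc ∑ y, ∑ x with a⁻¹ * x ∈ H, ν y * ν (y * x) ≤ ∑ y, ν y * η := by
        refine sum_le_sum fun y _ => ?_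
        rw [← mul_sum]
        refine mul_le_mul_of_nonneg_left (le_trans (le_of_eq ?_) (hη (y * a))) (h0 y)
        refine sum_equiv (Equiv.mulLeft y) (fun x => ?_) fun x _ => rfl
        simp [mul_assoc]
    _ = η := by rw [← sum_mul, h1, one_mul]

lemma iterCorr_nonneg {ν : G → ℝ} (h0 : ∀ x, 0 ≤ ν x) (j : ℕ) (x : G) : 0 ≤ iterCorr ν j x := by
  induction j generalizing x with
  | zero => exact sum_nonneg fun y _ => mul_nonneg (h0 _) (h0 _)
  | succ j ih => exact sum_nonneg fun y _ => mul_nonneg (ih _) (ih _)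

lemma sum_iterCorr {ν : G → ℝ} (h1 : ∑ x, ν x = 1) (j : ℕ) : ∑ x, iterCorr ν j x = 1 := by
  induction j with
  | zero => simp only [iterCorr]; rw [sum_corr, h1, one_mul]
  | succ j ih => simp only [iterCorr]; rw [sum_corr, ih, one_mul]

lemma sum_coset_iterCorr_le {ν : G → ℝ} (h0 : ∀ x, 0 ≤ ν x) (h1 : ∑ x, ν x = 1) {H : Subgroup G}
    {η : ℝ} (hη : ∀ a, ∑ x with a⁻¹ * x ∈ H, ν x ≤ η) (j : ℕ) (a : G) :
    ∑ x with a⁻¹ * x ∈ H, iterCorr ν j x ≤ η := by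
  induction j generalizing a with
  | zero => exact sum_coset_corr_le h0 h1 hη a
  | succ j ih => exact sum_coset_corr_le (iterCorr_nonneg h0 j) (sum_iterCorr h1 j) ih a

lemma norm_autocorr_le {f : G → ℂ} {ν : G → ℝ} {m : ℝ} (h : ∀ x, ‖f x‖ ≤ m * ν x) (x : G) :
    ‖autocorr f x‖ ≤ m ^ 2 * ∑ y, ν y * ν (y * x) := by
  refine (norm_sum_le _ _).trans ?_
  rw [mul_sum]
  refine sum_le_sum fun y _ => ?_
  rw [norm_mul, Complex.norm_conj]
  calc ‖f y‖ * ‖f (y * x)‖ ≤ (m * ν y) * (m * ν (y * x)) :=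
        mul_le_mul (h _) (h _) (norm_nonneg _) ((norm_nonneg _).trans (h _))
    _ = _ := by ring

lemma norm_iterAutocorr_le {f : G → ℂ} {ν : G → ℝ} {m : ℝ} (h : ∀ x, ‖f x‖ ≤ m * ν x) (j : ℕ)
    (x : G) : ‖iterAutocorr f j x‖ ≤ m ^ 2 ^ (j + 1) * iterCorr ν j x := by
  induction j generalizing x with
  | zero => exact norm_autocorr_le h x
  | succ j ih =>
    rw [pow_succ 2 (j + 1), pow_mul]
    exact norm_autocorr_le ih x

lemma sum_sq_corr_le {ν : G → ℝ} (h0 : ∀ x, 0 ≤ ν x) (h1 : ∑ x, ν x = 1) :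
    ∑ x, (∑ y, ν y * ν (y * x)) ^ 2 ≤ ∑ x, ν x ^ 2 := by
  calc ∑ x, (∑ y, ν y * ν (y * x)) ^ 2
      ≤ ∑ x, (∑ y, ν y * ν (y * x)) * ∑ z, ν z ^ 2 := by
        refine sum_le_sum fun x _ => ?_
        rw [sq]
        exact mul_le_mul_of_nonneg_left (corr_le_sum_sq ν x)
          (sum_nonneg fun y _ => mul_nonneg (h0 _) (h0 _))
    _ = ∑ x, ν x ^ 2 := by rw [← sum_mul, sum_corr, h1, one_mul, one_mul]

end RealAutocorrelation

/-- The numerical contradiction between flatness and the growth alternative. -/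
lemma false_of_growth_bounds {K η s n q L M : ℝ} (hK : 2 ≤ K) (hη0 : 0 ≤ η)
    (hKη : K ^ 5013 * η ≤ 1) (hKq : K ^ 12504 ≤ q) (hs0 : 0 ≤ s) (hsη : s ≤ η)
    (hs : 1 ≤ q ^ 5 * s ^ 2) (hL1 : 1 ≤ L) (hLK : L ≤ K ^ 46)
    (hM : M = (2 * L ^ 2) ^ 26 * (2 * L)) (hn : 0 ≤ n)
    (hlow : 1 ≤ 2 * L * (2 ^ 12 * K ^ 4) * s * n) (hup : n * s ≤ 2 * L * (2 ^ 24 * K ^ 6))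
    (h : n ≤ 1728 * 216 * M ^ 2 ∨ q ^ 6 ≤ 1728 * 6859 * M ^ 5 * n ^ 2) : False := by
  have hK1 : 1 ≤ K := by linarith
  have hK0 : 0 ≤ K := by linarith
  have h2K : ∀ n : ℕ, (2 : ℝ) ^ n ≤ K ^ n := fun n => pow_le_pow_left₀ (by norm_num) hK n
  obtain ⟨R, hR⟩ : ∃ R : ℝ, R = K ^ 46 := ⟨_, rfl⟩
  obtain ⟨Q, hQ⟩ : ∃ Q : ℝ, Q = K ^ 2465 := ⟨_, rfl⟩
  have hR0 : 0 ≤ R := hR ▸ pow_nonneg hK0 _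
  have hQ0 : 0 ≤ Q := hQ ▸ pow_nonneg hK0 _
  rw [← hR] at hLK
  have hMK : M ≤ Q := by
    have : (2 * L ^ 2) ^ 26 * (2 * L) ≤ (K * R ^ 2) ^ 26 * (K * R) := by gcongr
    rw [hM]
    refine this.trans (le_of_eq ?_)
    rw [hQ, hR]; ring
  have hM0 : 0 ≤ M := by rw [hM]; positivity
  rcases h with hc | hc
  · have h1 : n ≤ 2 ^ 19 * Q ^ 2 := by
      have : M ^ 2 ≤ Q ^ 2 := pow_le_pow_left₀ hM0 hMK 2
      have : 0 ≤ M ^ 2 := sq_nonneg M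
      norm_num
      linarith
    have h2 : 2 * L * (2 ^ 12 * K ^ 4) * s * n ≤
        K * R * (K ^ 12 * K ^ 4) * η * (K ^ 19 * Q ^ 2) := by
      have := h1.trans (mul_le_mul_of_nonneg_right (h2K 19) (sq_nonneg Q))
      have := h2K 12
      gcongr
    have h3 : K * R * (K ^ 12 * K ^ 4) * η * (K ^ 19 * Q ^ 2) * K = K ^ 5013 * η := by
      rw [hR, hQ]; ring
    nlinarith
  · have hs' : n * s ≤ K * R * (K ^ 24 * K ^ 6) := by
      refine hup.trans ?_
      have := h2K 24
      gcongr
    have hq : 0 < q := lt_of_lt_of_le (by positivity) hKq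
    have h5 : 1728 * 6859 * M ^ 5 ≤ K ^ 24 * Q ^ 5 := by
      have h1 : M ^ 5 ≤ Q ^ 5 := pow_le_pow_left₀ hM0 hMK 5
      have h2 : 0 ≤ M ^ 5 := pow_nonneg hM0 5
      have h3 := mul_le_mul_of_nonneg_right (h2K 24) (pow_nonneg hQ0 5)
      norm_num at h3
      linarith
    have h6 : q ^ 6 * s ^ 2 ≤ K ^ 24 * Q ^ 5 * (K * R * (K ^ 24 * K ^ 6)) ^ 2 := by
      calc q ^ 6 * s ^ 2 ≤ 1728 * 6859 * M ^ 5 * n ^ 2 * s ^ 2 :=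
            mul_le_mul_of_nonneg_right hc (sq_nonneg s)
        _ = 1728 * 6859 * M ^ 5 * (n * s) ^ 2 := by ring
        _ ≤ _ := mul_le_mul h5 (pow_le_pow_left₀ (mul_nonneg hn hs0) hs' 2) (sq_nonneg _)
            (by positivity)
    have h7 : q ≤ q ^ 6 * s ^ 2 := by
      calc q ≤ q * (q ^ 5 * s ^ 2) := le_mul_of_one_le_right hq.le hs
        _ = q ^ 6 * s ^ 2 := by ring
    have h8 : K ^ 24 * Q ^ 5 * (K * R * (K ^ 24 * K ^ 6)) ^ 2 * K = K ^ 12504 := by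
      rw [hR, hQ]; ring
    nlinarith

namespace SL2

open Matrix Matrix.SpecialLinearGroup
open scoped Pointwise

variable {F : Type*} [Field F] [DecidableEq F] [Fintype F]

/-- The `ℓ²` norm of a measure which is not concentrated on cosets of proper subgroups of `SL₂`
drops by a factor `K` under autocorrelation, until it is about `|F|^{-5/4}`. -/
lemma mul_sum_sq_corr_le (h2 : (2 : F) ≠ 0) (h3 : (3 : F) ≠ 0)
    {ν : SpecialLinearGroup (Fin 2) F → ℝ} (h0 : ∀ x, 0 ≤ ν x) (h1 : ∑ x, ν x = 1) {K η : ℝ}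
    (hK : 2 ≤ K) (hη0 : 0 ≤ η)
    (hη : ∀ H : Subgroup (SpecialLinearGroup (Fin 2) F), H ≠ ⊤ → ∀ a,
      ∑ x with a⁻¹ * x ∈ H, ν x ≤ η)
    (hKη : K ^ 12504 * η ≤ 1) (hKF : K ^ 12504 ≤ Fintype.card F)
    (hs : 1 ≤ (Fintype.card F : ℝ) ^ 5 * (∑ x, ν x ^ 2) ^ 2) :
    K * ∑ x, (∑ y, ν y * ν (y * x)) ^ 2 ≤ ∑ x, ν x ^ 2 := by
  by_contra! hE
  set s := ∑ x, ν x ^ 2 with hsdef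
  have hK1 : 1 ≤ K := by linarith
  have hK0 : 0 ≤ K := by linarith
  obtain ⟨L, hL⟩ : ∃ L : ℝ, L = 2 ^ 36 * K ^ 10 := ⟨_, rfl⟩
  have h2K : ∀ n : ℕ, (2 : ℝ) ^ n ≤ K ^ n := fun n => pow_le_pow_left₀ (by norm_num) hK n
  have hL1 : 1 ≤ L := by
    rw [hL]; exact one_le_mul_of_one_le_of_one_le (by norm_num) (one_le_pow₀ hK1)
  have hLK : L ≤ K ^ 46 := by
    rw [hL]
    calc (2 : ℝ) ^ 36 * K ^ 10 ≤ K ^ 36 * K ^ 10 := by gcongr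
      _ = K ^ 46 := by ring
  have hsmall : ∀ n : ℕ, n < 12504 → K ^ n * η < 1 := by
    intro n hn
    rcases hη0.eq_or_lt with rfl | hpos
    · simp
    · refine lt_of_lt_of_le ?_ hKη
      gcongr
      · linarith
  have hηK : 256 * K ^ 2 * L ^ 3 * η < 1 := by
    refine lt_of_le_of_lt ?_ (hsmall 148 (by norm_num))
    calc 256 * K ^ 2 * L ^ 3 * η = 2 ^ 8 * K ^ 2 * L ^ 3 * η := by norm_num
      _ ≤ K ^ 8 * K ^ 2 * (K ^ 46) ^ 3 * η := by gcongr
      _ = K ^ 148 * η := by ring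
  obtain ⟨S, hS1, hSinv, hStop, hgrow, hlow, hup⟩ :=
    exists_generating_approximate_subgroup ν h0 h1 hK1 hL hE.le hη hη0 hηK
  have hs0 : 0 ≤ s := sum_nonneg fun x _ => sq_nonneg _
  have hsη : s ≤ η := by
    have hbot : (⊥ : Subgroup (SpecialLinearGroup (Fin 2) F)) ≠ ⊤ := by
      intro h
      have h' : upper (1 : F) ∈ (⊥ : Subgroup (SpecialLinearGroup (Fin 2) F)) := by
        rw [h]; trivial
      have h'' := congrArg (fun x : SpecialLinearGroup (Fin 2) F => x 0 1) (Subgroup.mem_bot.1 h')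
      simp [upper] at h''
    have hmax : ∀ x, ν x ≤ η := by
      intro x
      exact (single_le_sum (fun y _ => h0 y) (by simp)).trans (hη ⊥ hbot x)
    calc s ≤ ∑ x, ν x * η := sum_le_sum fun x _ => by
          rw [sq]; exact mul_le_mul_of_nonneg_left (hmax x) (h0 x)
      _ = η := by rw [← sum_mul, h1, one_mul]
  obtain ⟨M, hM⟩ : ∃ M : ℝ, M = (2 * L ^ 2) ^ 26 * (2 * L) := ⟨_, rfl⟩
  have hM1 : 1 ≤ M := by
    rw [hM]
    refine one_le_mul_of_one_le_of_one_le (one_le_pow₀ ?_) (by linarith)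
    nlinarith
  have hgrow' : (#(S ^ 26) : ℝ) ≤ M * #S := by rw [hM]; exact hgrow 26
  exact false_of_growth_bounds hK hη0 (hsmall 5013 (by norm_num)).le hKF hs0 hsη hs hL1 hLK hM
    (Nat.cast_nonneg _) hlow hup
    (card_le_or_le_card_of_small_growth h2 h3 hM1 hS1 hSinv hStop hgrow')

end SL2

namespace SL2

open Matrix Matrix.SpecialLinearGroup

variable {F : Type*} [Field F] [DecidableEq F] [Fintype F]

lemma card_pow_five_mul_sum_sq_iterCorr_le (h2 : (2 : F) ≠ 0) (h3 : (3 : F) ≠ 0)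
    {ν : SpecialLinearGroup (Fin 2) F → ℝ} (h0 : ∀ x, 0 ≤ ν x) (h1 : ∑ x, ν x = 1) {K η : ℝ}
    (hK : 2 ≤ K) (hη0 : 0 ≤ η)
    (hη : ∀ H : Subgroup (SpecialLinearGroup (Fin 2) F), H ≠ ⊤ → ∀ a,
      ∑ x with a⁻¹ * x ∈ H, ν x ≤ η)
    (hKη : K ^ 12504 * η ≤ 1) (hKF : K ^ 12504 ≤ Fintype.card F) {j : ℕ}
    (hj : (Fintype.card F : ℝ) ^ 5 ≤ (K ^ j) ^ 2) :
    (Fintype.card F : ℝ) ^ 5 * (∑ x, iterCorr ν j x ^ 2) ^ 2 ≤ 1 := by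
  have hs0 : ∀ i, 0 ≤ ∑ x, iterCorr ν i x ^ 2 := fun i => sum_nonneg fun x _ => sq_nonneg _
  have key : ∀ i, K ^ i * ∑ x, iterCorr ν i x ^ 2 ≤ 1 ∨
      (Fintype.card F : ℝ) ^ 5 * (∑ x, iterCorr ν i x ^ 2) ^ 2 < 1 := by
    intro i
    induction i with
    | zero =>
      left
      rw [pow_zero, one_mul, ← sum_iterCorr h1 0]
      refine sum_le_sum fun x _ => ?_
      rw [sq]
      refine mul_le_of_le_one_left (iterCorr_nonneg h0 0 x) ?_
      rw [← sum_iterCorr h1 0]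
      exact single_le_sum (fun y _ => iterCorr_nonneg h0 0 y) (mem_univ x)
    | succ i ih =>
      by_cases hi : (Fintype.card F : ℝ) ^ 5 * (∑ x, iterCorr ν i x ^ 2) ^ 2 < 1
      · right
        refine lt_of_le_of_lt ?_ hi
        have := sum_sq_corr_le (iterCorr_nonneg h0 i) (sum_iterCorr h1 i)
        exact mul_le_mul_of_nonneg_left (pow_le_pow_left₀ (hs0 (i + 1)) this 2) (by positivity)
      · left
        have hflat := mul_sum_sq_corr_le h2 h3 (iterCorr_nonneg h0 i) (sum_iterCorr h1 i) hK hη0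
          (fun H hH a => sum_coset_iterCorr_le h0 h1 (hη H hH) i a) hKη hKF (not_lt.1 hi)
        calc K ^ (i + 1) * ∑ x, iterCorr ν (i + 1) x ^ 2
            = K ^ i * (K * ∑ x, iterCorr ν (i + 1) x ^ 2) := by ring
          _ ≤ K ^ i * ∑ x, iterCorr ν i x ^ 2 :=
              mul_le_mul_of_nonneg_left hflat (pow_nonneg (by linarith) i)
          _ ≤ 1 := ih.resolve_right hi
  rcases key j with h | h
  · calc (Fintype.card F : ℝ) ^ 5 * (∑ x, iterCorr ν j x ^ 2) ^ 2
        ≤ (K ^ j) ^ 2 * (∑ x, iterCorr ν j x ^ 2) ^ 2 := by gcongr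
      _ = (K ^ j * ∑ x, iterCorr ν j x ^ 2) ^ 2 := by ring
      _ ≤ 1 := pow_le_one₀ (mul_nonneg (pow_nonneg (by linarith) j) (hs0 j)) h
  · exact h.le

end SL2

/-- Extraction of the operator norm from the trace inequality. -/
lemma le_of_mul_pow_le {lam m q s D N : ℝ} {n : ℕ} (hn : n ≠ 0) (hq : 1 ≤ q)
    (hD : q ≤ 4 * D) (hN : N ≤ q ^ 3) (hs0 : 0 ≤ s)
    (hs : q ^ 5 * s ^ 2 ≤ 1) (h : D * lam ^ n ≤ N * ((m ^ 2) ^ n * s)) (hlam : 0 ≤ lam) :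
    lam ≤ 4 * q ^ (-(1 / (2 * n : ℝ))) * m ^ 2 := by
  have hq0 : 0 < q := by linarith
  have hn' : (n : ℝ) ≠ 0 := by exact_mod_cast hn
  have hsq : s ≤ q ^ (-(5 / 2) : ℝ) := by
    refine le_of_sq_le_sq ?_ (by positivity)
    rw [← Real.rpow_mul_natCast hq0.le]
    have : q ^ (-(5 / 2) * (2 : ℕ) : ℝ) = (q ^ 5)⁻¹ := by
      rw [← Real.rpow_natCast, ← Real.rpow_neg hq0.le]; norm_num
    rw [this, inv_eq_one_div, le_div_iff₀ (by positivity)]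
    linarith
  have h1 : q * lam ^ n ≤ 4 * q ^ (3 - 5 / 2 : ℝ) * (m ^ 2) ^ n := by
    calc q * lam ^ n ≤ 4 * D * lam ^ n := by gcongr
      _ = 4 * (D * lam ^ n) := by ring
      _ ≤ 4 * (N * ((m ^ 2) ^ n * s)) := by linarith
      _ ≤ 4 * (q ^ 3 * ((m ^ 2) ^ n * q ^ (-(5 / 2) : ℝ))) := by gcongr
      _ = 4 * q ^ (3 - 5 / 2 : ℝ) * (m ^ 2) ^ n := by
        rw [sub_eq_add_neg, Real.rpow_add hq0]; norm_cast; ring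
  have h2 : lam ^ n ≤ (4 * q ^ (-(1 / (2 * n : ℝ))) * m ^ 2) ^ n := by
    have e : (q ^ (-(1 / (2 * n : ℝ)))) ^ n = q ^ (-(1 / 2) : ℝ) := by
      rw [← Real.rpow_mul_natCast hq0.le]; congr 1; field_simp
    have e2 : q * q ^ (-(1 / 2) : ℝ) = q ^ (3 - 5 / 2 : ℝ) := by
      nth_rewrite 1 [← Real.rpow_one q]
      rw [← Real.rpow_add hq0]; norm_num
    rw [mul_pow, mul_pow, e]
    refine le_of_mul_le_mul_left ?_ hq0
    calc q * lam ^ n ≤ 4 * q ^ (3 - 5 / 2 : ℝ) * (m ^ 2) ^ n := h1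
      _ ≤ 4 ^ n * q ^ (3 - 5 / 2 : ℝ) * (m ^ 2) ^ n := by
        gcongr
        exact le_self_pow₀ (by norm_num) hn
      _ = q * (4 ^ n * q ^ (-(1 / 2) : ℝ) * (m ^ 2) ^ n) := by rw [← e2]; ring
  exact le_of_pow_le_pow_left₀ hn (by positivity) h2

/-- Lemma (`L²`-flattening for complex measures on `SL₂(𝔽_p)`).  Given `κ > 0` there are
`κ′ > 0`, `C > 0` and `p₀` such that for every prime `p ≥ p₀` and `G = SL₂(ℤ/pℤ)`: if
`μ : G → ℂ` satisfies `‖μ‖_∞ < p^{−κ} ‖μ‖₁` and `Σ_{x ∈ aG₁} |μ(x)| < p^{−κ} ‖μ‖₁` for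
every coset `aG₁` of every proper subgroup `G₁ < G`, then `‖μ ∗ φ‖₂ ≤ C p^{−κ′} ‖μ‖₁ ‖φ‖₂`
for every mean-zero `φ : G → ℂ`. -/
theorem l2_flattening_prime
    (κ : ℝ) (hκ : 0 < κ) :
    ∃ κ' > (0 : ℝ), ∃ C > (0 : ℝ), ∃ p₀ : ℕ,
      ∀ (p : ℕ) [NeZero p], p.Prime → p₀ ≤ p →
      ∀ μ : Matrix.SpecialLinearGroup (Fin 2) (ZMod p) → ℂ,
        (∀ x : Matrix.SpecialLinearGroup (Fin 2) (ZMod p), ‖μ x‖ < (p : ℝ) ^ (-κ) * l1Norm μ) →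
        (∀ G₁ : Subgroup (Matrix.SpecialLinearGroup (Fin 2) (ZMod p)), G₁ ≠ ⊤ →
          ∀ a : Matrix.SpecialLinearGroup (Fin 2) (ZMod p),
            ∑ x ∈ Finset.univ.filter (fun x => a⁻¹ * x ∈ G₁), ‖μ x‖ <
              (p : ℝ) ^ (-κ) * l1Norm μ) →
        ∀ φ : Matrix.SpecialLinearGroup (Fin 2) (ZMod p) → ℂ,
          (∑ x : Matrix.SpecialLinearGroup (Fin 2) (ZMod p), φ x) = 0 →
          l2Norm (conv μ φ) ≤ C * (p : ℝ) ^ (-κ') * l1Norm μ * l2Norm φ := by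
  obtain ⟨δ, hδ0, hδ1, hδκ⟩ : ∃ δ : ℝ, 0 < δ ∧ δ * 12504 ≤ 1 ∧ δ * 12504 ≤ κ :=
    ⟨min 1 κ / 12504, by positivity, by simp, by simp⟩
  obtain ⟨j, hj⟩ := exists_nat_ge (5 / (2 * δ))
  have hj' : 5 ≤ δ * j * 2 := by
    rw [div_le_iff₀ (by positivity)] at hj; linarith
  obtain ⟨p₁, hp₁⟩ := exists_nat_ge ((2 : ℝ) ^ δ⁻¹)
  obtain ⟨n, hn⟩ : ∃ n : ℕ, n = 2 ^ (j + 1) := ⟨_, rfl⟩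
  have hn0 : n ≠ 0 := by rw [hn]; positivity
  refine ⟨1 / (4 * n), by positivity, 2, two_pos, max 5 p₁, ?_⟩
  intro p _ hp hpp μ hμ hcoset φ hφ
  have : Fact p.Prime := ⟨hp⟩
  have hp5 : 5 ≤ p := (le_max_left _ _).trans hpp
  have hp0 : (0 : ℝ) < p := by exact_mod_cast hp.pos
  have hp1 : (1 : ℝ) ≤ p := by exact_mod_cast hp.one_lt.le
  set m := l1Norm μ
  have hm0 : 0 < m := by
    have := (norm_nonneg _).trans_lt (hμ 1)
    exact (pos_iff_pos_of_mul_pos this).1 (by positivity)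
  set K : ℝ := (p : ℝ) ^ δ
  have hK : 2 ≤ K := by
    have h : (2 : ℝ) ^ δ⁻¹ ≤ p := hp₁.trans (by exact_mod_cast (le_max_right _ _).trans hpp)
    calc (2 : ℝ) = (2 ^ δ⁻¹) ^ δ := by
          rw [← Real.rpow_mul (by norm_num), inv_mul_cancel₀ hδ0.ne', Real.rpow_one]
      _ ≤ K := Real.rpow_le_rpow (by positivity) h hδ0.le
  have hKpow : ∀ k : ℕ, K ^ k = (p : ℝ) ^ (δ * k) := fun k =>
    (Real.rpow_mul_natCast hp0.le δ k).symm
  have hnat : ∀ k : ℕ, 0 < k → k < 5 → (k : ZMod p) ≠ 0 := by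
    intro k hk hk5 h
    have := Nat.le_of_dvd hk ((ZMod.natCast_eq_zero_iff k p).1 h)
    omega
  have hcardF : (Fintype.card (ZMod p) : ℝ) = p := by rw [ZMod.card]
  let ν : Matrix.SpecialLinearGroup (Fin 2) (ZMod p) → ℝ := fun x => ‖μ x‖ / m
  have hν : ∀ x, ‖μ x‖ ≤ m * ν x := fun x => by
    simp only [ν]; rw [mul_div_cancel₀ _ hm0.ne']
  have hs := SL2.card_pow_five_mul_sum_sq_iterCorr_le (ν := ν) (K := K) (η := (p : ℝ) ^ (-κ))
    (j := j)
    (by exact_mod_cast hnat 2 (by norm_num) (by norm_num))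
    (by exact_mod_cast hnat 3 (by norm_num) (by norm_num))
    (fun x => by positivity)
    (by simp only [ν]; rw [← sum_div]; exact div_self hm0.ne') hK (by positivity)
    (fun H hH a => by
      simp only [ν]; rw [← sum_div, div_le_iff₀ hm0]; exact (hcoset H hH a).le)
    (by
      rw [hKpow, ← Real.rpow_add hp0]
      exact Real.rpow_le_one_of_one_le_of_nonpos hp1 (by push_cast; linarith))
    (by
      rw [hKpow, hcardF]
      exact (Real.rpow_le_rpow_of_exponent_le hp1 (by exact_mod_cast hδ1)).trans_eq
        (Real.rpow_one _))
    (by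
      rw [hKpow, hcardF, ← Real.rpow_mul_natCast hp0.le, ← Real.rpow_natCast]
      exact Real.rpow_le_rpow_of_exponent_le hp1 (by exact_mod_cast hj'))
  rw [hcardF] at hs
  obtain ⟨lam, hlam, hlam0, hmult⟩ := exists_spectral_bound μ (((p : ℝ) - 1) / 2)
    (fun V hV0 hVs hV => by
      have : (p : ℝ) ≤ 2 * Module.finrank ℂ V + 1 := by
        exact_mod_cast SL2.le_two_mul_finrank_add_one V hV0 hVs hV
      linarith)
  have hbound : lam ≤ 4 * (p : ℝ) ^ (-(1 / (2 * n : ℝ))) * m ^ 2 := by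
    refine le_of_mul_pow_le (s := ∑ x, iterCorr ν j x ^ 2) (D := ((p : ℝ) - 1) / 2)
      (N := Fintype.card (Matrix.SpecialLinearGroup (Fin 2) (ZMod p))) hn0 hp1 ?_ ?_
      (sum_nonneg fun x _ => sq_nonneg _) hs ?_ hlam0
    · have : (5 : ℝ) ≤ p := by exact_mod_cast hp5
      linarith
    · rw [← hcardF]
      exact_mod_cast SL2.card_le_pow_three
    · rw [hn, pow_succ, pow_mul]
      refine (hmult j).trans ?_
      gcongr
      rw [mul_sum]
      refine sum_le_sum fun x _ => ?_
      refine (pow_le_pow_left₀ (norm_nonneg _) (norm_iterAutocorr_le hν j x) 2).trans_eq ?_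
      rw [mul_pow]; ring
  have hfin : ∑ x, ‖conv μ φ x‖ ^ 2 ≤
      (2 * (p : ℝ) ^ (-(1 / (4 * n : ℝ))) * m) ^ 2 * ∑ x, ‖φ x‖ ^ 2 := by
    refine (hlam φ hφ).trans (mul_le_mul_of_nonneg_right (hbound.trans_eq ?_)
      (sum_nonneg fun x _ => sq_nonneg _))
    rw [mul_pow, mul_pow, ← Real.rpow_mul_natCast hp0.le]
    have e : -(1 / (2 * n : ℝ)) = -(1 / (4 * n : ℝ)) * (2 : ℕ) := by push_cast; ring
    rw [e]; norm_num
  simp only [l2Norm]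
  refine (Real.sqrt_le_sqrt hfin).trans_eq ?_
  rw [Real.sqrt_mul (sq_nonneg _), Real.sqrt_sq (by positivity)]
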